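/- arXiv:math/0211204 — 8 statements merged into one kernel-verified Lean document; each statement's English description precedes it below -/
import Mathlib

section
/- Let S be a countable abelian semigroup such that for every s ∈ S there exist s', s'' ∈ S with s = s' + s''. Let G be a countably infinite abelian group such that the dilation 2∗G = {g + g : g ∈ G} is infinite. Consider the abelian semigroup X = S ⊕ G with projection map π : X → G defined by π(s,g) = g. Let f : X → ℕ₀ ∪ {∞} be any map such that the set Z₀ = π(f⁻¹(0)) is a finite subset of G. Then there exists a set B ⊆ X such that r̂_B(x) = f(x) for all x ∈ X. -/
/-- The restricted representation function of a subset `B` of an additive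
semigroup: `restrictedRep B x` counts the number of sets `{b, b'} ⊆ B`
with `b ≠ b'` and `b + b' = x`. -/
noncomputable def restrictedRep {X : Type*} [Add X] (B : Set X) (x : X) : ℕ∞ :=
  {s : Set X | ∃ b ∈ B, ∃ b' ∈ B, b ≠ b' ∧ b + b' = x ∧ s = {b, b'}}.encard

open scoped Pointwise

section RestrictedRep

variable {X : Type*} [AddCommSemigroup X]

theorem restrictedRep_mono {B C : Set X} (h : B ⊆ C) (x : X) :
    restrictedRep B x ≤ restrictedRep C x := by
  refine Set.encard_le_encard ?_
  rintro s ⟨b, hb, b', hb', hs⟩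
  exact ⟨b, h hb, b', h hb', hs⟩

theorem restrictedRep_eq_zero {B : Set X} {x : X}
    (h : ∀ a ∈ B, ∀ a' ∈ B, a ≠ a' → a + a' ≠ x) : restrictedRep B x = 0 := by
  rw [restrictedRep, Set.encard_eq_zero, Set.eq_empty_iff_forall_notMem]
  rintro s ⟨b, hb, b', hb', hne, hx, -⟩
  exact h b hb b' hb' hne hx

theorem mem_pairs_insert {B : Set X} {b x : X} {s : Set X}
    (hs : ∃ a ∈ insert b B, ∃ a' ∈ insert b B, a ≠ a' ∧ a + a' = x ∧ s = {a, a'}) :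
    (∃ a ∈ B, ∃ a' ∈ B, a ≠ a' ∧ a + a' = x ∧ s = {a, a'}) ∨
      ∃ a ∈ B, b + a = x ∧ s = {b, a} := by
  obtain ⟨a, ha, a', ha', hne, hx, rfl⟩ := hs
  rcases ha with rfl | ha <;> rcases ha' with rfl | ha'
  · exact absurd rfl hne
  · exact .inr ⟨a', ha', hx, rfl⟩
  · exact .inr ⟨a, ha, by rw [add_comm, hx], Set.pair_comm _ _⟩
  · exact .inl ⟨a, ha, a', ha', hne, hx, rfl⟩

theorem restrictedRep_insert_le {B : Set X} {b x : X} (h : ∀ a ∈ B, b + a ≠ x) :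
    restrictedRep (insert b B) x ≤ restrictedRep B x := by
  refine Set.encard_le_encard fun s hs => ?_
  rcases mem_pairs_insert hs with hs | ⟨a, ha, hx, -⟩
  · exact hs
  · exact absurd hx (h a ha)

theorem restrictedRep_insert_le_add_one {B : Set X} {b : X}
    (h : Set.InjOn (fun a => b + a) B) (x : X) :
    restrictedRep (insert b B) x ≤ restrictedRep B x + 1 := by
  have hsub : {s : Set X | ∃ a ∈ B, b + a = x ∧ s = {b, a}}.encard ≤ 1 := by
    rw [Set.encard_le_one_iff]
    rintro s t ⟨a, ha, hx, rfl⟩ ⟨a', ha', hx', rfl⟩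
    rw [h ha ha' (hx.trans hx'.symm)]
  refine le_trans (Set.encard_le_encard fun s hs => mem_pairs_insert hs) ?_
  exact (Set.encard_union_le _ _).trans (add_le_add le_rfl hsub)

theorem restrictedRep_add_one_le {B : Set X} {b b' x : X} (hb : b ∉ B) (hb' : b' ∈ B)
    (hx : b + b' = x) : restrictedRep B x + 1 ≤ restrictedRep (insert b B) x := by
  have hnot : ({b, b'} : Set X) ∉
      {s : Set X | ∃ a ∈ B, ∃ a' ∈ B, a ≠ a' ∧ a + a' = x ∧ s = {a, a'}} := by
    rintro ⟨a, ha, a', ha', -, -, hs⟩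
    have : b ∈ ({a, a'} : Set X) := hs ▸ Set.mem_insert _ _
    rcases this with rfl | rfl
    exacts [hb ha, hb ha']
  rw [restrictedRep, ← Set.encard_insert_of_notMem hnot]
  refine Set.encard_le_encard ?_
  rintro s (rfl | ⟨a, ha, a', ha', hs⟩)
  · exact ⟨b, .inl rfl, b', .inr hb', fun h => hb (h ▸ hb'), hx, rfl⟩
  · exact ⟨a, .inr ha, a', .inr ha', hs⟩

theorem restrictedRep_iUnion_le {B : ℕ → Set X} (hB : Monotone B) {x : X} {n : ℕ∞}
    (h : ∀ k, restrictedRep (B k) x ≤ n) : restrictedRep (⋃ k, B k) x ≤ n := by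
  by_contra! hlt
  have hn : n ≠ ⊤ := hlt.ne_top
  obtain ⟨t, ht, htn⟩ := Set.exists_subset_encard_eq (Order.add_one_le_of_lt hlt)
  have htfin : t.Finite := by
    rw [← Set.encard_ne_top_iff, htn]
    simpa using hn
  have hk : ∃ k, t ⊆ {s | ∃ a ∈ B k, ∃ a' ∈ B k, a ≠ a' ∧ a + a' = x ∧ s = {a, a'}} := by
    clear htn
    induction t, htfin using Set.Finite.induction_on with
    | empty => exact ⟨0, Set.empty_subset _⟩
    | @insert s t _ _ ih =>
      obtain ⟨k, hk⟩ := ih ((Set.subset_insert _ _).trans ht)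
      obtain ⟨a, ha, a', ha', hs⟩ := ht (Set.mem_insert s t)
      obtain ⟨i, hi⟩ := Set.mem_iUnion.1 ha
      obtain ⟨j, hj⟩ := Set.mem_iUnion.1 ha'
      refine ⟨i ⊔ j ⊔ k, Set.insert_subset ?_ fun u hu => ?_⟩
      · exact ⟨a, hB (le_sup_left.trans le_sup_left) hi, a',
          hB (le_sup_right.trans le_sup_left) hj, hs⟩
      · obtain ⟨c, hc, c', hc', hu⟩ := hk hu
        exact ⟨c, hB le_sup_right hc, c', hB le_sup_right hc', hu⟩
  obtain ⟨k, hk⟩ := hk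
  have h1 : n + 1 ≤ n := htn ▸ (Set.encard_le_encard hk).trans (h k)
  exact absurd h1 (not_le.2 (ENat.lt_add_one_iff hn |>.2 le_rfl))

end RestrictedRep

theorem exists_notMem_and_add_self_notMem {G : Type*} [Add G]
    (hG : (Set.range fun g : G => g + g).Infinite) {E F : Set G} (hE : E.Finite)
    (hF : F.Finite) : ∃ c, c ∉ E ∧ c + c ∉ F := by
  obtain ⟨_, ⟨c, rfl⟩, hc⟩ := hG.exists_notMem_finite (hF.union (hE.image fun g => g + g))
  exact ⟨c, fun h => hc (.inr ⟨c, h, rfl⟩), fun h => hc (.inl h)⟩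

section Extension

variable {S G : Type*} [AddCommSemigroup S] [AddCommGroup G]

theorem injOn_add_left_of_injOn_snd {B : Set (S × G)} (h : Set.InjOn Prod.snd B) (b : S × G) :
    Set.InjOn (fun a => b + a) B := fun a ha a' ha' haa' =>
  h ha ha' (add_left_cancel (congrArg Prod.snd haa' : b.2 + a.2 = b.2 + a'.2))

/-- A finite set with injective projection whose restricted representation function is bounded
by `f`. -/
structure IsAdmissible (f : S × G → ℕ∞) (B : Set (S × G)) : Prop where
  finite : B.Finite
  injOn : Set.InjOn Prod.snd B
  le : ∀ x, restrictedRep B x ≤ f x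

theorem IsAdmissible.insert_of_add_one_le {f : S × G → ℕ∞} {B : Set (S × G)} (hB : IsAdmissible f B)
    {b : S × G} (hb : ∀ a ∈ B, b.2 ≠ a.2)
    (h : ∀ a ∈ B, restrictedRep B (b + a) + 1 ≤ f (b + a)) : IsAdmissible f (insert b B) where
  finite := hB.finite.insert b
  injOn := by
    rw [Set.injOn_insert fun hmem => hb b hmem rfl]
    refine ⟨hB.injOn, ?_⟩
    rintro ⟨a, ha, hab⟩
    exact hb a ha hab.symm
  le x := by
    by_cases hx : ∃ a ∈ B, b + a = x
    · obtain ⟨a, ha, rfl⟩ := hx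
      exact (restrictedRep_insert_le_add_one (injOn_add_left_of_injOn_snd hB.injOn b) _).trans
        (h a ha)
    · push Not at hx
      exact (restrictedRep_insert_le hx).trans (hB.le x)

theorem IsAdmissible.exists_extension
    (hS : ∀ s : S, ∃ s' s'' : S, s = s' + s'')
    (hG : (Set.range fun g : G => g + g).Infinite)
    {f : S × G → ℕ∞} (hf : (Prod.snd '' (f ⁻¹' {0})).Finite)
    {B : Set (S × G)} (hB : IsAdmissible f B) {x : S × G} (hx : restrictedRep B x < f x) :
    ∃ C, IsAdmissible f C ∧ B ⊆ C ∧ restrictedRep B x + 1 ≤ restrictedRep C x := by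
  obtain ⟨s, g⟩ := x
  obtain ⟨s', s'', rfl⟩ := hS s
  set Z := Prod.snd '' (f ⁻¹' {0})
  set P := Prod.snd '' B
  have hPfin : P.Finite := hB.finite.image _
  have hgfin : ({g} : Set G).Finite := Set.finite_singleton g
  obtain ⟨c, hcE, hcF⟩ := exists_notMem_and_add_self_notMem hG
    (E := P ∪ ({g} - P) ∪ (Z - P) ∪ (P + P - P) ∪ ({g} + P - Z) ∪ ({g} + P - (P + P)))
    (F := {g} ∪ ({g} + P - P))
    (((((hPfin.union (hgfin.sub hPfin)).union (hf.sub hPfin)).union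
      ((hPfin.add hPfin).sub hPfin)).union ((hgfin.add hPfin).sub hf)).union
      ((hgfin.add hPfin).sub (hPfin.add hPfin)))
    (hgfin.union ((hgfin.add hPfin).sub hPfin))
  simp only [Set.mem_union, not_or] at hcE hcF
  obtain ⟨⟨⟨⟨⟨h1, h2⟩, h3⟩, h4⟩, h5⟩, h6⟩ := hcE
  obtain ⟨h7, h8⟩ := hcF
  have memP : ∀ a ∈ B, a.2 ∈ P := fun a ha => Set.mem_image_of_mem _ ha
  have pos : ∀ y : S × G, y.2 ∉ Z → 1 ≤ f y := fun y hy =>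
    Order.one_le_iff_pos.2 (pos_iff_ne_zero.2 fun h => hy ⟨y, h, rfl⟩)
  have hcP : ∀ a ∈ B, c ≠ a.2 := fun a ha h => h1 (h ▸ memP a ha)
  have hcg : ∀ a ∈ B, c + a.2 ≠ g := fun a ha h =>
    h2 ⟨g, rfl, a.2, memP a ha, by simp [← h]⟩
  have hcZ : ∀ a ∈ B, c + a.2 ∉ Z := fun a ha h =>
    h3 ⟨_, h, a.2, memP a ha, by simp⟩
  have hcPP : ∀ a ∈ B, ∀ p ∈ B, ∀ q ∈ B, p.2 + q.2 ≠ c + a.2 := fun a ha p hp q hq h =>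
    h4 ⟨_, Set.add_mem_add (memP p hp) (memP q hq), a.2, memP a ha, by simp [h]⟩
  have hdZ : ∀ a ∈ B, g - c + a.2 ∉ Z := fun a ha h =>
    h5 ⟨_, Set.add_mem_add rfl (memP a ha), _, h, by simp only; abel⟩
  have hdPP : ∀ a ∈ B, ∀ p ∈ B, ∀ q ∈ B, p.2 + q.2 ≠ g - c + a.2 := fun a ha p hp q hq h =>
    h6 ⟨_, Set.add_mem_add rfl (memP a ha), _,
      Set.add_mem_add (memP p hp) (memP q hq), by simp only [h]; abel⟩
  have hcc : c + c ≠ g := h7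
  have hcd : ∀ a ∈ B, ∀ p ∈ B, c + p.2 ≠ g - c + a.2 := fun a ha p hp h =>
    h8 ⟨_, Set.add_mem_add rfl (memP a ha), p.2, memP p hp, by
      have : c + c = c + (c + p.2) - p.2 := by abel
      rw [this, h]; simp only; abel⟩
  have hB₁ : IsAdmissible f (insert (s', c) B) := hB.insert_of_add_one_le hcP fun a ha => by
    rw [restrictedRep_eq_zero fun p hp q hq _ h =>
      hcPP a ha p hp q hq (congrArg Prod.snd h),
      zero_add]
    exact pos _ (hcZ a ha)
  have hx₁ : restrictedRep (insert (s', c) B) (s' + s'', g) ≤ restrictedRep B (s' + s'', g) :=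
    restrictedRep_insert_le fun a ha h => hcg a ha (congrArg Prod.snd h)
  have hd : ∀ a ∈ insert (s', c) B, g - c ≠ a.2 := by
    rintro a (rfl | ha) h
    · exact hcc (sub_eq_iff_eq_add.1 h).symm
    · exact hcg a ha (by rw [← h]; abel)
  have hsum : (s'', g - c) + (s', c) = (s' + s'', g) := by
    rw [Prod.mk_add_mk, add_comm s'', sub_add_cancel]
  refine ⟨insert (s'', g - c) (insert (s', c) B), hB₁.insert_of_add_one_le hd ?_,
    (Set.subset_insert _ _).trans (Set.subset_insert _ _), ?_⟩
  · rintro a (rfl | ha)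
    · rw [hsum]
      exact (add_le_add_left hx₁ 1).trans (Order.add_one_le_of_lt hx)
    · rw [restrictedRep_eq_zero, zero_add]
      · exact pos _ (hdZ a ha)
      rintro p hp q hq hne h
      replace h : p.2 + q.2 = g - c + a.2 := congrArg Prod.snd h
      rcases hp with rfl | hp <;> rcases hq with rfl | hq
      · exact hne rfl
      · exact hcd a ha q hq h
      · exact hcd a ha p hp (by rw [← h, add_comm])
      · exact hdPP a ha p hp q hq h
  · refine le_trans (add_le_add_left (restrictedRep_mono (Set.subset_insert _ _) _) 1)
      (restrictedRep_add_one_le (fun hmem => hd _ hmem rfl) (Set.mem_insert _ _) hsum)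

end Extension

theorem stmt0 {S G : Type*} [AddCommSemigroup S] [Countable S]
    [AddCommGroup G] [Countable G] [Infinite G]
    (hS : ∀ s : S, ∃ s' s'' : S, s = s' + s'')
    (hG : (Set.range fun g : G => g + g).Infinite)
    (f : S × G → ℕ∞)
    (hf : (Prod.snd '' (f ⁻¹' {0})).Finite) :
    ∃ B : Set (S × G), ∀ x : S × G, restrictedRep B x = f x := by
  rcases isEmpty_or_nonempty (S × G) with hX | hX
  · exact ⟨∅, fun x => (hX.false x).elim⟩
  obtain ⟨e, he⟩ := exists_surjective_nat (S × G)
  have step (x : S × G) (B : {B // IsAdmissible f B}) : ∃ C : {C // IsAdmissible f C},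
      B.1 ⊆ C.1 ∧ (restrictedRep B.1 x < f x →
        restrictedRep B.1 x + 1 ≤ restrictedRep C.1 x) := by
    by_cases hx : restrictedRep B.1 x < f x
    · obtain ⟨C, hC, hBC, h⟩ := B.2.exists_extension hS hG hf hx
      exact ⟨⟨C, hC⟩, hBC, fun _ => h⟩
    · exact ⟨B, subset_rfl, fun h => absurd h hx⟩
  choose F hsub hF using step
  have hempty : IsAdmissible f ∅ :=
    ⟨Set.finite_empty, Set.injOn_empty _, fun x => by
      rw [restrictedRep_eq_zero fun a ha => absurd ha (Set.notMem_empty a)]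
      exact zero_le⟩
  let B : ℕ → {B // IsAdmissible f B} :=
    fun k => Nat.rec ⟨∅, hempty⟩ (fun k C => F (e k.unpair.1) C) k
  have hmono : Monotone fun k => (B k).1 := monotone_nat_of_le_succ fun k => hsub _ (B k)
  refine ⟨⋃ k, (B k).1, fun x => le_antisymm
    (restrictedRep_iUnion_le hmono fun k => (B k).2.le x) ?_⟩
  obtain ⟨i, rfl⟩ := he x
  have key (n : ℕ) (hn : n ≤ f (e i)) : ∃ k, n ≤ restrictedRep (B k).1 (e i) := by
    induction n with
    | zero => exact ⟨0, by simp⟩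
    | succ n ih =>
      obtain ⟨m, hm⟩ := ih (le_trans (by simp) hn)
      have hmk : n ≤ restrictedRep (B (Nat.pair i m)).1 (e i) :=
        hm.trans (restrictedRep_mono (hmono (Nat.right_le_pair i m)) _)
      by_cases hlt : restrictedRep (B (Nat.pair i m)).1 (e i) < f (e i)
      · refine ⟨Nat.pair i m + 1, ?_⟩
        have h := hF (e i) (B (Nat.pair i m)) hlt
        have hB : B (Nat.pair i m + 1) = F (e i) (B (Nat.pair i m)) := by
          change F (e (Nat.pair i m).unpair.1) (B (Nat.pair i m)) = _
          rw [Nat.unpair_pair]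
        rw [hB, Nat.cast_add, Nat.cast_one]
        exact (add_le_add_left hmk 1).trans h
      · exact ⟨_, hn.trans (not_lt.1 hlt)⟩
  refine ENat.forall_natCast_le_iff_le.1 fun n hn => ?_
  obtain ⟨k, hk⟩ := key n hn
  exact hk.trans (restrictedRep_mono (Set.subset_iUnion (fun k => (B k).1) k) _)
end

section
/- Let S be a countable abelian semigroup such that for every s ∈ S there exist s', s'' ∈ S with s = s' + s''. Let G be a countably infinite abelian group such that the dilation 12∗G = {12g : g ∈ G} is infinite. Consider the abelian semigroup X = S ⊕ G. Let f : X → ℕ₀ ∪ {∞} be any map such that the set Z₀ = f⁻¹(0) is finite. Then there exists a set B ⊆ X such that r_B(x) = f(x) for all x ∈ X. -/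
/-- The (unrestricted) representation function of a subset `B` of an additive
semigroup: `rep B x` counts the number of sets `{b, b'} ⊆ B` (with `b = b'`
allowed) such that `b + b' = x`. -/
noncomputable def rep {X : Type*} [Add X] (B : Set X) (x : X) : ℕ∞ :=
  {s : Set X | ∃ b ∈ B, ∃ b' ∈ B, b + b' = x ∧ s = {b, b'}}.encard

/-- The family of sets counted by `rep B x`. -/
def repSets {X : Type*} [Add X] (B : Set X) (x : X) : Set (Set X) :=
  {s : Set X | ∃ b ∈ B, ∃ b' ∈ B, b + b' = x ∧ s = {b, b'}}

theorem rep_eq_encard_repSets {X : Type*} [Add X] (B : Set X) (x : X) :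
    rep B x = (repSets B x).encard := rfl

theorem repSets_mono {X : Type*} [Add X] {B B' : Set X} (h : B ⊆ B') (x : X) :
    repSets B x ⊆ repSets B' x := by
  rintro s ⟨b, hb, b', hb', hx, rfl⟩
  exact ⟨b, h hb, b', h hb', hx, rfl⟩

theorem rep_mono {X : Type*} [Add X] {B B' : Set X} (h : B ⊆ B') (x : X) :
    rep B x ≤ rep B' x :=
  Set.encard_le_encard (repSets_mono h x)

theorem repSets_iUnion {X : Type*} [Add X] {B : ℕ → Set X} (hB : Monotone B) (x : X) :
    repSets (⋃ n, B n) x = ⋃ n, repSets (B n) x := by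
  apply subset_antisymm
  · rintro s ⟨b, hb, b', hb', hx, rfl⟩
    obtain ⟨i, hi⟩ := Set.mem_iUnion.1 hb
    obtain ⟨j, hj⟩ := Set.mem_iUnion.1 hb'
    exact Set.mem_iUnion.2 ⟨max i j, b, hB (le_max_left i j) hi, b',
      hB (le_max_right i j) hj, hx, rfl⟩
  · exact Set.iUnion_subset fun n => repSets_mono (Set.subset_iUnion B n) x

theorem encard_iUnion_le_of_monotone {α : Type*} {A : ℕ → Set α} (hA : Monotone A) {m : ℕ∞}
    (h : ∀ n, (A n).encard ≤ m) : (⋃ n, A n).encard ≤ m := by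
  refine ENat.forall_natCast_le_iff_le.1 fun k hk => ?_
  obtain ⟨t, ht, htk⟩ := Set.exists_subset_encard_eq hk
  have hfin : t.Finite := Set.finite_of_encard_eq_coe htk
  obtain ⟨n, hn⟩ := hA.directed_le.exists_mem_subset_of_finset_subset_biUnion
    (s := hfin.toFinset) (by simpa using ht)
  rw [← htk]
  exact (Set.encard_le_encard (by simpa using hn)).trans (h n)

theorem rep_iUnion_le {X : Type*} [Add X] {B : ℕ → Set X} (hB : Monotone B) {x : X} {m : ℕ∞}
    (h : ∀ n, rep (B n) x ≤ m) : rep (⋃ n, B n) x ≤ m := by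
  rw [rep_eq_encard_repSets, repSets_iUnion hB]
  exact encard_iUnion_le_of_monotone (fun _ _ hij => repSets_mono (hB hij) x) h

/-- If `12 • G` is infinite, some `c` has all of `c`, `2c`, `3c`, `4c` outside a given finite set. -/
theorem exists_small_multiples_notMem {G : Type*} [AddCommGroup G]
    (hG : (Set.range fun g : G => (12 : ℕ) • g).Infinite) {F : Set G} (hF : F.Finite) :
    ∃ c : G, c ∉ F ∧ 2 • c ∉ F ∧ 3 • c ∉ F ∧ 4 • c ∉ F := by
  have hbad : ((fun z : G => 12 • z) '' F ∪ (fun z : G => 6 • z) '' F ∪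
      (fun z : G => 4 • z) '' F ∪ (fun z : G => 3 • z) '' F).Finite :=
    (((hF.image _).union (hF.image _)).union (hF.image _)).union (hF.image _)
  obtain ⟨_, ⟨c, rfl⟩, hc⟩ := hG.exists_notMem_finite hbad
  refine ⟨c, fun h => hc ?_, fun h => hc ?_, fun h => hc ?_, fun h => hc ?_⟩
  · exact .inl (.inl (.inl ⟨_, h, rfl⟩))
  · exact .inl (.inl (.inr ⟨_, h, by simp only [smul_smul]; norm_num⟩))
  · exact .inl (.inr ⟨_, h, by simp only [smul_smul]; norm_num⟩)
  · exact .inr ⟨_, h, by simp only [smul_smul]; norm_num⟩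

/-- Given finite sets `P` (used values) and `Z` (forbidden sums), `g` splits as `c + d` such that
the sums involving `c` or `d`, other than `g`, avoid each other, `P + P` and `Z`. -/
theorem exists_generic_split {G : Type*} [AddCommGroup G]
    (hG : (Set.range fun g : G => (12 : ℕ) • g).Infinite) {P Z : Set G}
    (hP : P.Finite) (hZ : Z.Finite) (g : G) :
    ∃ c d : G, c + d = g ∧ c ≠ d ∧ c ∉ P ∧ d ∉ P ∧ c + c ≠ d + d ∧
      c + c ∉ Z ∧ d + d ∉ Z ∧
      (∀ p ∈ P, c + p ∉ Z ∧ d + p ∉ Z ∧ c + c ≠ d + p ∧ d + d ≠ c + p) ∧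
      (∀ p ∈ P, ∀ q ∈ P, c + c ≠ p + q ∧ d + d ≠ p + q ∧ c + p ≠ d + q) ∧
      ∀ p ∈ P, ∀ q ∈ P, ∀ r ∈ P, c + p ≠ q + r ∧ d + p ≠ q + r := by
  set Q : Set G := {0, g} ∪ P ∪ Z with hQ
  have hQfin : Q.Finite := ((Set.toFinite _).union hP).union hZ
  have h0 : (0 : G) ∈ Q := by simp [hQ]
  have hg : g ∈ Q := by simp [hQ]
  have hPQ : ∀ p ∈ P, p ∈ Q := fun p hp => .inl (.inr hp)
  have hZQ : ∀ z ∈ Z, z ∈ Q := fun z hz => .inr hz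
  set F : Set G := Set.image2 (· - ·) (Set.image2 (· + ·) Q Q) (Set.image2 (· + ·) Q Q)
  have hF : F.Finite := (hQfin.image2 _ hQfin).image2 _ (hQfin.image2 _ hQfin)
  have mem : ∀ {a b e h y : G}, a ∈ Q → b ∈ Q → e ∈ Q → h ∈ Q → y = a + b - (e + h) → y ∈ F := by
    rintro a b e h y ha hb he hh rfl
    exact ⟨_, ⟨a, ha, b, hb, rfl⟩, _, ⟨e, he, h, hh, rfl⟩, rfl⟩
  obtain ⟨c, h1, h2, h3, h4⟩ := exists_small_multiples_notMem hG hF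
  refine ⟨c, g - c, by abel, fun h => h2 (mem hg h0 h0 h0 ?_),
    fun h => h1 (mem (hPQ _ h) h0 h0 h0 ?_), fun h => h1 (mem hg h0 (hPQ _ h) h0 ?_),
    fun h => h4 (mem hg hg h0 h0 ?_), fun h => h2 (mem (hZQ _ h) h0 h0 h0 ?_),
    fun h => h2 (mem hg hg (hZQ _ h) h0 ?_),
    fun p hp => ⟨fun h => h1 (mem (hZQ _ h) h0 (hPQ _ hp) h0 ?_),
      fun h => h1 (mem hg (hPQ _ hp) (hZQ _ h) h0 ?_),
      fun h => h3 (mem hg (hPQ _ hp) h0 h0 ?_),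
      fun h => h3 (mem hg hg (hPQ _ hp) h0 ?_)⟩,
    fun p hp q hq => ⟨fun h => h2 (mem (hPQ _ hp) (hPQ _ hq) h0 h0 ?_),
      fun h => h2 (mem hg hg (hPQ _ hp) (hPQ _ hq) ?_),
      fun h => h2 (mem hg (hPQ _ hq) (hPQ _ hp) h0 ?_)⟩,
    fun p hp q hq r hr => ⟨fun h => h1 (mem (hPQ _ hq) (hPQ _ hr) (hPQ _ hp) h0 ?_),
      fun h => h1 (mem hg (hPQ _ hp) (hPQ _ hq) (hPQ _ hr) ?_)⟩⟩
  all_goals first | abel1 | grind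

/-- Two equal sums over `{c, d} ∪ P`, different from `c + d` and not coming from `P + P`, agree up
to the order of the summands, provided `c` and `d` are generic. -/
theorem eq_or_eq_of_add_eq_add {G : Type*} [AddCommGroup G] {P : Set G} {c d : G}
    (hcd : c + c ≠ d + d) (h1 : ∀ p ∈ P, c + c ≠ d + p ∧ d + d ≠ c + p)
    (h2 : ∀ p ∈ P, ∀ q ∈ P, c + c ≠ p + q ∧ d + d ≠ p + q ∧ c + p ≠ d + q)
    (h3 : ∀ p ∈ P, ∀ q ∈ P, ∀ r ∈ P, c + p ≠ q + r ∧ d + p ≠ q + r) {w x y z : G}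
    (hw : w ∈ insert c (insert d P)) (hx : x ∈ insert c (insert d P))
    (hy : y ∈ insert c (insert d P)) (hz : z ∈ insert c (insert d P))
    (hsum : w + x = y + z) (hne : w + x ≠ c + d) (hP : ¬ (w ∈ P ∧ x ∈ P)) :
    w = y ∨ w = z := by
  rcases hw with rfl | rfl | hw <;> rcases hx with rfl | rfl | hx <;>
    rcases hy with rfl | rfl | hy <;> rcases hz with rfl | rfl | hz <;> grind

/-- A finite partial solution with one representation of `x` missing extends to one with it. -/
theorem exists_finite_extension {S G : Type*} [AddCommSemigroup S] [AddCommGroup G]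
    (hS : ∀ s : S, ∃ s' s'' : S, s = s' + s'')
    (hG : (Set.range fun g : G => (12 : ℕ) • g).Infinite)
    {f : S × G → ℕ∞} (hf : (f ⁻¹' {0}).Finite) {B : Set (S × G)} (hB : B.Finite)
    (hinj : Set.InjOn Prod.snd B) (hBf : ∀ y, rep B y ≤ f y) {x : S × G}
    (hx : rep B x < f x) :
    ∃ B' : Set (S × G), B ⊆ B' ∧ B'.Finite ∧ Set.InjOn Prod.snd B' ∧ (∀ y, rep B' y ≤ f y) ∧
      rep B x + 1 ≤ rep B' x := by
  obtain ⟨s', s'', hs⟩ := hS x.1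
  obtain ⟨c, d, hcd, hne, hcP, hdP, hccdd, hccZ, hddZ, h1, h2, h3⟩ :=
    exists_generic_split hG (hB.image Prod.snd) (hf.image Prod.snd) x.2
  set u : S × G := (s', c)
  set v : S × G := (s'', d)
  have hu2 : u.2 = c := rfl
  have hv2 : v.2 = d := rfl
  have huv : u + v = x := Prod.ext hs.symm hcd
  have hmem : ∀ b ∈ B, b.2 ∈ Prod.snd '' B := fun b hb => ⟨b, hb, rfl⟩
  have huB : u ∉ B := fun h => hcP (hmem _ h)
  set B' : Set (S × G) := insert u (insert v B) with hB'
  have hsub : B ⊆ B' := fun b hb => .inr (.inr hb)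
  have hnew : ({u, v} : Set (S × G)) ∉ repSets B x := by
    rintro ⟨b, hb, b', hb', -, h⟩
    have : u ∈ ({b, b'} : Set (S × G)) := h ▸ Set.mem_insert u _
    rcases this with rfl | rfl <;> exact huB ‹_›
  have hinj' : Set.InjOn Prod.snd B' := by
    rintro a (rfl | rfl | ha) b (rfl | rfl | hb) hab
    all_goals first | rfl | exact hinj ha hb hab | grind
  have hrepx : repSets B' x = insert {u, v} (repSets B x) := by
    apply subset_antisymm
    · rintro s ⟨a, ha, b, hb, hab, rfl⟩
      have hab2 : a.2 + b.2 = c + d := by rw [← Prod.snd_add, hab, hcd]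
      rcases ha with rfl | rfl | ha <;> rcases hb with rfl | rfl | hb
      · grind
      · exact .inl rfl
      · grind
      · exact .inl (Set.pair_comm _ _)
      · grind
      · grind
      · grind
      · grind
      · exact .inr ⟨a, ha, b, hb, hab, rfl⟩
    · rintro s (rfl | hs)
      · exact ⟨u, .inl rfl, v, .inr (.inl rfl), huv, rfl⟩
      · exact repSets_mono hsub x hs
  have hrep : rep B' x = rep B x + 1 := by
    rw [rep_eq_encard_repSets, hrepx, Set.encard_insert_of_notMem hnew, rep_eq_encard_repSets]
  refine ⟨B', hsub, (hB.insert v).insert u, hinj', fun y => ?_, hrep.ge⟩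
  by_cases hyx : y = x
  · rw [hyx, hrep]
    exact Order.add_one_le_of_lt hx
  by_cases hold : repSets B' y ⊆ repSets B y
  · exact (Set.encard_le_encard hold).trans (hBf y)
  obtain ⟨_, ⟨a, ha, b, hb, hab, rfl⟩, hnot⟩ := Set.not_subset.1 hold
  have hnotBB : ¬ (a ∈ B ∧ b ∈ B) := fun h => hnot ⟨a, h.1, b, h.2, hab, rfl⟩
  have hab2 : a.2 + b.2 = y.2 := congrArg Prod.snd hab
  have hyZ : y.2 ∉ Prod.snd '' (f ⁻¹' {0}) := by
    rw [← hab2]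
    rcases ha with rfl | rfl | ha <;> rcases hb with rfl | rfl | hb
    · exact hccZ
    · exact absurd (hab.symm.trans huv) hyx
    · exact (h1 _ (hmem b hb)).1
    · exact absurd (hab.symm.trans ((add_comm _ _).trans huv)) hyx
    · exact hddZ
    · exact (h1 _ (hmem b hb)).2.1
    · rw [add_comm]; exact (h1 _ (hmem a ha)).1
    · rw [add_comm]; exact (h1 _ (hmem a ha)).2.1
    · exact absurd ⟨ha, hb⟩ hnotBB
  have hfy : 1 ≤ f y := by
    rw [Order.one_le_iff_pos, pos_iff_ne_zero]
    exact fun h => hyZ ⟨y, h, rfl⟩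
  refine le_trans (Set.encard_le_one_iff_subsingleton.2 ?_) hfy
  have huniq : ∀ a' ∈ B', ∀ b' ∈ B', a' + b' = y → ({a', b'} : Set (S × G)) = {a, b} := by
    intro a' ha' b' hb' hab'
    have key : a'.2 + b'.2 = a.2 + b.2 := by rw [hab2, ← hab']; rfl
    have hT : ∀ t ∈ B', t.2 ∈ insert c (insert d (Prod.snd '' B)) := by
      rintro t (rfl | rfl | ht)
      exacts [.inl rfl, .inr (.inl rfl), .inr (.inr (hmem t ht))]
    have hPP : ¬ (a.2 ∈ Prod.snd '' B ∧ b.2 ∈ Prod.snd '' B) := by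
      rintro ⟨⟨a₀, ha₀, haa⟩, b₀, hb₀, hbb⟩
      rw [← hinj' ha (hsub ha₀) haa.symm] at ha₀
      rw [← hinj' hb (hsub hb₀) hbb.symm] at hb₀
      exact hnotBB ⟨ha₀, hb₀⟩
    have hne2 : a.2 + b.2 ≠ c + d := by
      rcases ha with rfl | rfl | ha <;> rcases hb with rfl | rfl | hb
      · grind
      · exact absurd (hab.symm.trans huv) hyx
      · grind
      · exact absurd (hab.symm.trans ((add_comm _ _).trans huv)) hyx
      all_goals grind
    rcases eq_or_eq_of_add_eq_add hccdd (fun p hp => (h1 p hp).2.2) h2 h3 (hT a ha) (hT b hb)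
      (hT a' ha') (hT b' hb') key.symm hne2 hPP with h | h
    · rw [hinj' ha ha' h, hinj' hb hb' (by grind)]
    · rw [hinj' ha hb' h, hinj' hb ha' (by grind), Set.pair_comm]
  rintro _ ⟨a₁, ha₁, b₁, hb₁, hab₁, rfl⟩ _ ⟨a₂, ha₂, b₂, hb₂, hab₂, rfl⟩
  rw [huniq _ ha₁ _ hb₁ hab₁, huniq _ ha₂ _ hb₂ hab₂]

theorem exists_forall_infinite_preimage (X : Type*) [Countable X] [Nonempty X] :
    ∃ e : ℕ → X, ∀ x, ∀ N, ∃ n ≥ N, e n = x := by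
  obtain ⟨e, he⟩ := exists_surjective_nat X
  refine ⟨fun n => e n.unpair.1, fun x N => ?_⟩
  obtain ⟨m, rfl⟩ := he x
  exact ⟨Nat.pair m N, Nat.right_le_pair m N, by simp⟩

theorem stmt2 {S G : Type*} [AddCommSemigroup S] [Countable S]
    [AddCommGroup G] [Countable G] [Infinite G]
    (hS : ∀ s : S, ∃ s' s'' : S, s = s' + s'')
    (hG : (Set.range fun g : G => (12 : ℕ) • g).Infinite)
    (f : S × G → ℕ∞)
    (hf : (f ⁻¹' {0}).Finite) :
    ∃ B : Set (S × G), ∀ x : S × G, rep B x = f x := by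
  cases isEmpty_or_nonempty S with
  | inl _ => exact ⟨∅, fun x => isEmptyElim x.1⟩
  | inr _ =>
  obtain ⟨e, he⟩ := exists_forall_infinite_preimage (S × G)
  let good : Set (S × G) → Prop := fun B =>
    B.Finite ∧ Set.InjOn Prod.snd B ∧ ∀ y, rep B y ≤ f y
  have step : ∀ (x : S × G) (B : {B // good B}), ∃ B' : {B // good B},
      B.1 ⊆ B'.1 ∧ (rep B.1 x < f x → rep B.1 x + 1 ≤ rep B'.1 x) := by
    rintro x ⟨B, hB, hinj, hBf⟩
    by_cases hx : rep B x < f x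
    · obtain ⟨B', h1, h2, h3, h4, h5⟩ := exists_finite_extension hS hG hf hB hinj hBf hx
      exact ⟨⟨B', h2, h3, h4⟩, h1, fun _ => h5⟩
    · exact ⟨⟨B, hB, hinj, hBf⟩, subset_rfl, fun h => absurd h hx⟩
  choose next hsub hnext using step
  have good_empty : good ∅ := by
    refine ⟨Set.finite_empty, Set.injOn_empty _, fun y => ?_⟩
    have : repSets (∅ : Set (S × G)) y = ∅ :=
      Set.eq_empty_of_forall_notMem fun _ ⟨_, hb, _⟩ => hb
    simp [rep_eq_encard_repSets, this]
  let C : ℕ → {B // good B} := fun n => Nat.rec ⟨∅, good_empty⟩ (fun k B => next (e k) B) n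
  have hmono : Monotone fun n => (C n).1 := monotone_nat_of_le_succ fun n => hsub (e n) (C n)
  refine ⟨⋃ n, (C n).1, fun x =>
    le_antisymm (rep_iUnion_le hmono fun n => (C n).2.2.2 x) ?_⟩
  have grow : ∀ k : ℕ, (k : ℕ∞) ≤ f x → ∃ n, (k : ℕ∞) ≤ rep (C n).1 x := by
    intro k
    induction k with
    | zero => exact fun _ => ⟨0, by simp⟩
    | succ k ih =>
      intro hk
      obtain ⟨N, hN⟩ := ih (le_trans (by simp) hk)
      obtain ⟨n, hn, hnx⟩ := he x N
      have hkn : (k : ℕ∞) ≤ rep (C n).1 x := hN.trans (rep_mono (hmono hn) x)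
      by_cases hlt : rep (C n).1 x < f x
      · refine ⟨n + 1, ?_⟩
        subst hnx
        push_cast
        exact (add_le_add_left hkn 1).trans (hnext (e n) (C n) hlt)
      · exact ⟨n, hk.trans (not_lt.1 hlt)⟩
  refine ENat.forall_natCast_le_iff_le.1 fun k hk => ?_
  obtain ⟨n, hn⟩ := grow k hk
  exact hn.trans (rep_mono (Set.subset_iUnion (fun n => (C n).1) n) x)
end

section
/- Let h ≥ 2 be an integer and let G be a countably infinite abelian group. The dilation h∗G = {hg : g ∈ G} is finite if and only if G is isomorphic to G₀ ⊕ (⊕_{d | h, d ≥ 2} G_d), where G₀ is a finite abelian group and, for each divisor d ≥ 2 of h, G_d is a direct sum of (possibly zero) cyclic groups of order d. -/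
/-- A family of nonzero elements of an abelian group which generates the group and such that every
vanishing integral combination has only vanishing terms; the group is then the internal direct sum
of the cyclic subgroups generated by the members of the family. -/
structure IsCyclicBasis {ι G : Type} [AddCommGroup G] (x : ι → G) : Prop where
  ne_zero : ∀ i, x i ≠ 0
  smul_eq_zero : ∀ a : ι →₀ ℤ, Finsupp.linearCombination ℤ x a = 0 → ∀ i, a i • x i = 0
  exists_eq : ∀ g : G, ∃ a : ι →₀ ℤ, Finsupp.linearCombination ℤ x a = g

/-- A basis of an `𝔽_p`-quotient of an elementary abelian `p`-group, lifted to the group. -/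
theorem exists_lift_basis {V Q : Type} [AddCommGroup V] [AddCommGroup Q] (p : ℕ) [Fact p.Prime]
    [Module (ZMod p) Q] (hV : ∀ v : V, p • v = 0) (π : V →+ Q) (hπ : Function.Surjective π) :
    ∃ (κ : Type) (k : κ → V), (∀ j, k j ≠ 0) ∧
      (∀ c : κ →₀ ℤ, π (Finsupp.linearCombination ℤ k c) = 0 → ∀ j, c j • k j = 0) ∧
      ∀ v : V, ∃ c : κ →₀ ℤ, π (v - Finsupp.linearCombination ℤ k c) = 0 := by
  let b := Module.Basis.ofVectorSpace (ZMod p) Q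
  choose k hk using fun j => hπ (b j)
  have key : ∀ c, π (Finsupp.linearCombination ℤ k c) =
      Finsupp.linearCombination (ZMod p) b
        (c.mapRange (fun n : ℤ => (n : ZMod p)) (by simp)) := by
    intro c
    rw [Finsupp.linearCombination_apply, Finsupp.linearCombination_apply, map_finsuppSum,
      Finsupp.sum_mapRange_index (by simp)]
    refine Finsupp.sum_congr fun j _ => ?_
    rw [map_zsmul, Int.cast_smul_eq_zsmul, hk]
  refine ⟨_, k, fun j hj => ?_, fun c hc j => ?_, fun v => ?_⟩
  · apply b.ne_zero j
    rw [← hk j, hj, map_zero]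
  · rw [key] at hc
    have h2 := DFunLike.congr_fun (linearIndependent_iff.1 b.linearIndependent _ hc) j
    simp only [Finsupp.mapRange_apply, Finsupp.coe_zero, Pi.zero_apply] at h2
    obtain ⟨m, hm⟩ := (ZMod.intCast_zmod_eq_zero_iff_dvd _ p).1 h2
    rw [hm, mul_comm, mul_smul, natCast_zsmul, hV, smul_zero]
  · let c : _ →₀ ℤ := (b.repr (π v)).mapRange (fun z : ZMod p => (z.cast : ℤ)) (by simp)
    refine ⟨c, ?_⟩
    have : c.mapRange (fun n : ℤ => (n : ZMod p)) (by simp) = b.repr (π v) := by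
      ext j
      simp [c]
    rw [map_sub, key, this, b.linearCombination_repr, sub_self]

/-- Lifts to an elementary abelian `p`-group of a basis of its quotient by a subgroup. -/
theorem exists_family_of_prime_smul_eq_zero {V : Type} [AddCommGroup V] (p : ℕ) [Fact p.Prime]
    (hV : ∀ v : V, p • v = 0) (W : AddSubgroup V) :
    ∃ (κ : Type) (k : κ → V), (∀ j, k j ≠ 0) ∧
      (∀ c : κ →₀ ℤ, Finsupp.linearCombination ℤ k c ∈ W → ∀ j, c j • k j = 0) ∧
      ∀ v : V, ∃ c : κ →₀ ℤ, v - Finsupp.linearCombination ℤ k c ∈ W := by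
  have hQ : ∀ q : V ⧸ W, p • q = 0 := by
    intro q
    obtain ⟨v, rfl⟩ := QuotientAddGroup.mk_surjective q
    rw [← QuotientAddGroup.mk_nsmul, hV, QuotientAddGroup.mk_zero]
  let _ : Module (ZMod p) (V ⧸ W) := AddCommGroup.zmodModule hQ
  simpa only [QuotientAddGroup.mk'_apply, QuotientAddGroup.eq_zero_iff] using
    exists_lift_basis p hV (QuotientAddGroup.mk' W) (QuotientAddGroup.mk'_surjective W)

/-- Every element `y` of `pG` has a `p`-th root such that all multiples of the root killed by `p`
lie in the subgroup generated by `y`. -/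
theorem exists_prime_root {G : Type} [AddCommGroup G] (p : ℕ) (hp : p.Prime) (x : G) :
    ∃ x' : G, p • x' = p • x ∧
      ∀ a : ℤ, a • (p • x) = 0 → ∃ b : ℤ, a • x' = b • (p • x) := by
  by_cases hd : p ∣ addOrderOf (p • x)
  · refine ⟨x, rfl, fun a ha => ?_⟩
    obtain ⟨b, rfl⟩ := (Int.natCast_dvd_natCast.2 hd).trans (addOrderOf_dvd_iff_zsmul_eq_zero.2 ha)
    exact ⟨b, by rw [mul_comm, mul_smul, natCast_zsmul]⟩
  · have hc : IsCoprime (p : ℤ) (addOrderOf (p • x) : ℤ) :=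
      Nat.isCoprime_iff_coprime.2 ((Nat.Prime.coprime_iff_not_dvd hp).2 hd)
    obtain ⟨u, v, huv⟩ := hc
    refine ⟨u • (p • x), ?_, fun a _ => ⟨a * u, by rw [mul_smul]⟩⟩
    have h1 : (u * p + v * (addOrderOf (p • x) : ℤ)) • (p • x) = p • x := by rw [huv, one_smul]
    rw [add_smul, mul_smul, mul_smul, natCast_zsmul, natCast_zsmul, addOrderOf_nsmul_eq_zero,
      smul_zero, add_zero] at h1
    rw [smul_comm, h1]

/-- **Prüfer's first theorem**: an abelian group of bounded exponent is a direct sum of cyclic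
groups. -/
theorem exists_isCyclicBasis (n : ℕ) (hn : n ≠ 0) {G : Type} [AddCommGroup G]
    (hG : ∀ g : G, n • g = 0) : ∃ (ι : Type) (x : ι → G), IsCyclicBasis x := by
  induction n using Nat.strong_induction_on generalizing G with
  | _ n ih =>
  by_cases h1 : n = 1
  · subst h1
    exact ⟨Empty, Empty.elim, fun i => i.elim, fun _ _ i => i.elim,
      fun g => ⟨0, by simpa using (hG g).symm⟩⟩
  obtain ⟨p, hp, m, rfl⟩ := Nat.exists_prime_and_dvd h1
  have : Fact p.Prime := ⟨hp⟩
  have hm : m ≠ 0 := by rintro rfl; simp at hn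
  obtain ⟨ι, y, hy⟩ := ih m (by nlinarith [hp.two_le, Nat.pos_of_ne_zero hm]) hm
    (G := (nsmulAddMonoidHom (α := G) p).range) (by
      rintro ⟨_, g, rfl⟩
      ext
      simpa [← mul_smul, mul_comm m p] using hG g)
  have hroot : ∀ i, ∃ x' : G, p • x' = (y i : G) ∧
      ∀ a : ℤ, a • (y i : G) = 0 → ∃ b : ℤ, a • x' = b • (y i : G) := by
    intro i
    obtain ⟨g, hg⟩ := (y i).2
    change p • g = (y i : G) at hg
    rw [← hg]
    exact exists_prime_root p hp g
  choose x hxy hx using hroot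
  have hyl : ∀ a : ι →₀ ℤ, ((Finsupp.linearCombination ℤ y a : _) : G) =
      Finsupp.linearCombination ℤ (fun i => (y i : G)) a := by
    intro a
    exact map_finsuppSum (nsmulAddMonoidHom (α := G) p).range.subtype a _
  have hpx : ∀ a : ι →₀ ℤ, p • Finsupp.linearCombination ℤ x a =
      Finsupp.linearCombination ℤ (fun i => (y i : G)) a := by
    intro a
    rw [Finsupp.linearCombination_apply, Finsupp.linearCombination_apply, Finsupp.smul_sum]
    exact Finsupp.sum_congr fun i _ => by rw [smul_comm, hxy]
  have hyG : ∀ a : ι →₀ ℤ, Finsupp.linearCombination ℤ (fun i => (y i : G)) a = 0 →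
      ∀ i, a i • (y i : G) = 0 := by
    intro a ha i
    have := hy.smul_eq_zero a (Subtype.ext (by rw [hyl, ha]; rfl)) i
    exact congrArg Subtype.val this
  have hxind : ∀ a : ι →₀ ℤ, Finsupp.linearCombination ℤ x a = 0 → ∀ i, a i • x i = 0 := by
    intro a ha
    have hay := hyG a (by rw [← hpx, ha, smul_zero])
    choose b hb using fun i => hx i (a i) (hay i)
    classical
    let b' : ι →₀ ℤ := Finsupp.onFinset a.support (fun i => if a i = 0 then 0 else b i)
      (fun i hi => by
        rw [Finsupp.mem_support_iff]
        intro h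
        exact hi (if_pos h))
    have hb' : ∀ i, a i • x i = b' i • (y i : G) := by
      intro i
      by_cases h0 : a i = 0
      · simp [b', h0]
      · simp only [b', Finsupp.onFinset_apply, if_neg h0]
        exact hb i
    have hsum : Finsupp.linearCombination ℤ (fun i => (y i : G)) b' = 0 := by
      rw [← ha, Finsupp.linearCombination_apply, Finsupp.linearCombination_apply,
        Finsupp.sum, Finsupp.sum,
        Finset.sum_subset (Finsupp.support_onFinset_subset : b'.support ⊆ a.support)]
      · exact Finset.sum_congr rfl fun i _ => (hb' i).symm
      · intro i _ hi
        rw [Finsupp.notMem_support_iff.1 hi, zero_smul]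
    intro i
    rw [hb', hyG b' hsum i]
  let V := (nsmulAddMonoidHom (α := G) p).ker
  let H : AddSubgroup G := (Finsupp.linearCombination ℤ x).toAddMonoidHom.range
  obtain ⟨κ, k, hk0, hkind, hkspan⟩ := exists_family_of_prime_smul_eq_zero (V := V) p
    (fun v => Subtype.ext v.2) (H.comap V.subtype)
  have hkl : ∀ c : κ →₀ ℤ, ((Finsupp.linearCombination ℤ k c : V) : G) =
      Finsupp.linearCombination ℤ (fun j => (k j : G)) c := by
    intro c
    exact map_finsuppSum V.subtype c _
  have hsplit : ∀ a : ι ⊕ κ →₀ ℤ,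
      Finsupp.linearCombination ℤ (Sum.elim x (fun j => (k j : G))) a =
        Finsupp.linearCombination ℤ x (Finsupp.sumFinsuppEquivProdFinsupp a).1 +
        Finsupp.linearCombination ℤ (fun j => (k j : G))
          (Finsupp.sumFinsuppEquivProdFinsupp a).2 := by
    intro a
    have hsum : a = (Finsupp.sumFinsuppEquivProdFinsupp a).1.mapDomain Sum.inl +
        (Finsupp.sumFinsuppEquivProdFinsupp a).2.mapDomain Sum.inr := by
      ext (i | j)
      · simp [Finsupp.mapDomain_apply Sum.inl_injective, Finsupp.mapDomain_of_notMem_range]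
      · simp [Finsupp.mapDomain_apply Sum.inr_injective, Finsupp.mapDomain_of_notMem_range]
    conv_lhs => rw [hsum]
    rw [map_add, Finsupp.linearCombination_mapDomain, Finsupp.linearCombination_mapDomain]
    rfl
  refine ⟨ι ⊕ κ, Sum.elim x (fun j => (k j : G)), ?_, ?_, ?_⟩
  · rintro (i | j)
    · intro h
      change x i = 0 at h
      apply hy.ne_zero i
      ext
      rw [← hxy i, h, smul_zero]
      rfl
    · intro h
      exact hk0 j (Subtype.ext h)
  · intro a ha
    rw [hsplit] at ha
    have hc := hkind (Finsupp.sumFinsuppEquivProdFinsupp a).2 (by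
      change ((Finsupp.linearCombination ℤ k _ : V) : G) ∈ H
      rw [hkl, ← neg_eq_of_add_eq_zero_right ha]
      exact H.neg_mem ⟨_, rfl⟩)
    have hc0 : Finsupp.linearCombination ℤ (fun j => (k j : G))
        (Finsupp.sumFinsuppEquivProdFinsupp a).2 = 0 := by
      rw [Finsupp.linearCombination_apply]
      exact Finset.sum_eq_zero fun j _ => congrArg Subtype.val (hc j)
    rw [hc0, add_zero] at ha
    rintro (i | j)
    · exact hxind _ ha i
    · exact congrArg Subtype.val (hc j)
  · intro g
    obtain ⟨a, ha⟩ := hy.exists_eq ⟨p • g, g, rfl⟩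
    have ha' : p • Finsupp.linearCombination ℤ x a = p • g := by
      rw [hpx, ← hyl, ha]
    obtain ⟨c, a', hc⟩ := hkspan ⟨g - Finsupp.linearCombination ℤ x a, by
      change p • (g - Finsupp.linearCombination ℤ x a) = 0
      rw [smul_sub, ha', sub_self]⟩
    change Finsupp.linearCombination ℤ x a' = g - Finsupp.linearCombination ℤ x a -
      ((Finsupp.linearCombination ℤ k c : V) : G) at hc
    rw [hkl] at hc
    refine ⟨Finsupp.sumFinsuppEquivProdFinsupp.symm (a' + a, c), ?_⟩
    rw [hsplit, Equiv.apply_symm_apply]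
    simp only [map_add]
    rw [hc]
    abel

/-- A family of elements of prescribed orders without nontrivial relations generates a direct sum
of cyclic groups. -/
theorem nonempty_span_equiv_dfinsupp_zmod {κ G : Type} [AddCommGroup G] (n : κ → ℕ) (y : κ → G)
    (hn : ∀ k, addOrderOf (y k) = n k)
    (hy : ∀ a : κ →₀ ℤ, Finsupp.linearCombination ℤ y a = 0 → ∀ k, a k • y k = 0) :
    Nonempty (Submodule.span ℤ (Set.range y) ≃+ Π₀ k, ZMod (n k)) := by
  classical
  have hz : ∀ k, zmultiplesHom G (y k) (n k : ℤ) = 0 := by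
    intro k
    rw [zmultiplesHom_apply, natCast_zsmul, ← hn, addOrderOf_nsmul_eq_zero]
  let F : (Π₀ k, ZMod (n k)) →+ G :=
    DFinsupp.sumAddHom fun k => ZMod.lift (n k) ⟨zmultiplesHom G (y k), hz k⟩
  have hsingle : ∀ k (m : ℤ), F (DFinsupp.single k (m : ZMod (n k))) = m • y k := by
    intro k m
    simp [F]
  have hF : ∀ z : Π₀ k, ZMod (n k), ∃ a : κ →₀ ℤ, (∀ k, ((a k : ℤ) : ZMod (n k)) = z k) ∧
      F z = Finsupp.linearCombination ℤ y a := by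
    intro z
    refine ⟨Finsupp.onFinset z.support (fun k => (z k).cast) ?_, ?_, ?_⟩
    · intro k hk
      rw [DFinsupp.mem_support_iff]
      intro h
      rw [h] at hk
      simp at hk
    · intro k
      simp
    · rw [Finsupp.linearCombination_apply, Finsupp.onFinset_sum _ (by simp)]
      simp only [F, DFinsupp.sumAddHom_apply, DFinsupp.sum]
      refine Finset.sum_congr rfl fun k _ => ?_
      conv_lhs => rw [← ZMod.intCast_zmod_cast (z k)]
      rw [ZMod.lift_coe]
      rfl
  have hinj : Function.Injective F := by
    rw [injective_iff_map_eq_zero]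
    intro z hz0
    obtain ⟨a, haz, hFa⟩ := hF z
    ext k
    rw [← haz k, DFinsupp.zero_apply, ZMod.intCast_zmod_eq_zero_iff_dvd, ← hn]
    exact addOrderOf_dvd_iff_zsmul_eq_zero.2 (hy a (hFa ▸ hz0) k)
  have hrange : F.range = (Submodule.span ℤ (Set.range y)).toAddSubgroup := by
    ext g
    rw [Submodule.mem_toAddSubgroup, Finsupp.mem_span_range_iff_exists_finsupp]
    constructor
    · rintro ⟨z, rfl⟩
      obtain ⟨a, -, hFa⟩ := hF z
      exact ⟨a, hFa.symm⟩
    · rintro ⟨a, rfl⟩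
      exact F.range.sum_mem fun k _ => ⟨_, hsingle k (a k)⟩
  exact ⟨((AddMonoidHom.ofInjective hinj).trans (AddEquiv.addSubgroupCongr hrange)).symm⟩

namespace IsCyclicBasis

variable {ι G : Type} [AddCommGroup G] {x : ι → G}

theorem smul_eq_zero_comp (hx : IsCyclicBasis x) {κ : Type} {f : κ → ι}
    (hf : Function.Injective f) (a : κ →₀ ℤ)
    (ha : Finsupp.linearCombination ℤ (fun k => x (f k)) a = 0) (k : κ) : a k • x (f k) = 0 := by
  have := hx.smul_eq_zero (a.mapDomain f)
    (by rw [Finsupp.linearCombination_mapDomain]; exact ha) (f k)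
  rwa [Finsupp.mapDomain_apply hf] at this

theorem isCompl_span (hx : IsCyclicBasis x) (S : Set ι) :
    IsCompl (Submodule.span ℤ (x '' S)) (Submodule.span ℤ (x '' Sᶜ)) := by
  constructor
  · rw [Submodule.disjoint_def]
    intro g hS hSc
    obtain ⟨a, haS, rfl⟩ := (Finsupp.mem_span_image_iff_linearCombination ℤ).1 hS
    obtain ⟨b, hbS, hb⟩ := (Finsupp.mem_span_image_iff_linearCombination ℤ).1 hSc
    have h0 := hx.smul_eq_zero (a - b) (by rw [map_sub, hb, sub_self])
    rw [Finsupp.linearCombination_apply]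
    refine Finset.sum_eq_zero fun i hi => ?_
    have hbi : b i = 0 := by
      by_contra h
      exact hbS (Finsupp.mem_support_iff.2 h) (haS hi)
    simpa [hbi] using h0 i
  · rw [codisjoint_iff, ← Submodule.span_union, ← Set.image_union, Set.union_compl_self,
      Set.image_univ, eq_top_iff]
    exact fun g _ => Finsupp.mem_span_range_iff_exists_finsupp.2 (hx.exists_eq g)

theorem finite_setOf_not_dvd (hx : IsCyclicBasis x) {h : ℕ}
    (hfin : (Set.range fun g : G => h • g).Finite) :
    {i | ¬ addOrderOf (x i) ∣ h}.Finite := by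
  refine Set.Finite.of_injOn (f := fun i => h • x i) (fun i _ => Set.mem_range_self (x i)) ?_ hfin
  intro i hi j _ hij
  by_contra hne
  have := hx.smul_eq_zero (Finsupp.single i (h : ℤ) - Finsupp.single j (h : ℤ))
    (by simpa [sub_eq_zero] using hij) i
  rw [Finsupp.sub_apply, Finsupp.single_eq_same, Finsupp.single_eq_of_ne hne, sub_zero,
    natCast_zsmul] at this
  exact hi (addOrderOf_dvd_of_nsmul_eq_zero this)

end IsCyclicBasis

theorem exists_nsmul_eq_zero_of_finite_range {G : Type} [AddCommGroup G] {h : ℕ} (hh : h ≠ 0)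
    (hfin : (Set.range fun g : G => h • g).Finite) : ∃ n ≠ 0, ∀ g : G, n • g = 0 := by
  have : Finite (nsmulAddMonoidHom (α := G) h).range := hfin
  refine ⟨Nat.card (nsmulAddMonoidHom (α := G) h).range * h,
    mul_ne_zero Nat.card_pos.ne' hh, fun g => ?_⟩
  have := card_nsmul_eq_zero' (x := (⟨h • g, g, rfl⟩ : (nsmulAddMonoidHom (α := G) h).range))
  rw [mul_smul]
  exact congrArg Subtype.val this

theorem stmt4 (h : ℕ) (hh : 2 ≤ h) {G : Type} [AddCommGroup G] [Countable G] [Infinite G] :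
    (Set.range fun g : G => h • g).Finite ↔
      ∃ (G₀ : Type) (_ : AddCommGroup G₀) (_ : Finite G₀)
        (I : {d : ℕ // d ∣ h ∧ 2 ≤ d} → Type),
        Nonempty (G ≃+ G₀ × (Π₀ p : (Σ d : {d : ℕ // d ∣ h ∧ 2 ≤ d}, I d), ZMod p.1.1)) := by
  constructor
  · intro hfin
    obtain ⟨n, hn, hnG⟩ := exists_nsmul_eq_zero_of_finite_range (by omega) hfin
    obtain ⟨ι, x, hx⟩ := exists_isCyclicBasis n hn hnG
    let S : Set ι := {i | ¬ addOrderOf (x i) ∣ h}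
    have hS : S.Finite := hx.finite_setOf_not_dvd hfin
    let I : {d : ℕ // d ∣ h ∧ 2 ≤ d} → Type := fun d => {i : ι // addOrderOf (x i) = d.1}
    have hfinite : Finite (Submodule.span ℤ (x '' S)) := by
      have : Module.Finite ℤ (Submodule.span ℤ (x '' S)) :=
        Module.Finite.span_of_finite ℤ (hS.image x)
      refine Module.finite_of_fg_torsion _ fun {g} => ?_
      exact ⟨⟨(n : ℤ), mem_nonZeroDivisors_of_ne_zero (by exact_mod_cast hn)⟩,
        Subtype.ext (by simpa using hnG (g : G))⟩
    have hinj : Function.Injective fun p : Σ d, I d => p.2.1 := by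
      rintro ⟨⟨d, hd⟩, i, hi⟩ ⟨⟨d', hd'⟩, i', hi'⟩ hii
      change i = i' at hii
      subst hii
      change addOrderOf (x i) = d at hi
      change addOrderOf (x i) = d' at hi'
      subst hi
      subst hi'
      rfl
    have hrange : Set.range (fun p : Σ d, I d => x p.2.1) = x '' Sᶜ := by
      ext g
      constructor
      · rintro ⟨⟨d, i, hi⟩, rfl⟩
        exact ⟨i, fun hiS => hiS (hi ▸ d.2.1), rfl⟩
      · rintro ⟨i, hi, rfl⟩
        have hdvd : addOrderOf (x i) ∣ h := not_not.1 hi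
        have h1 : addOrderOf (x i) ≠ 1 := fun h => hx.ne_zero i (AddMonoid.addOrderOf_eq_one_iff.1 h)
        have h0 := Nat.pos_of_dvd_of_pos hdvd (by omega)
        exact ⟨⟨⟨addOrderOf (x i), hdvd, by omega⟩, i, rfl⟩, rfl⟩
    obtain ⟨e⟩ := nonempty_span_equiv_dfinsupp_zmod (fun p : Σ d, I d => p.1.1)
      (fun p => x p.2.1) (fun p => p.2.2) (hx.smul_eq_zero_comp hinj)
    rw [hrange] at e
    exact ⟨_, _, hfinite, I,
      ⟨(Submodule.prodEquivOfIsCompl _ _ (hx.isCompl_span S)).symm.toAddEquiv.trans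
        (AddEquiv.prodCongr (AddEquiv.refl _) e)⟩⟩
  · rintro ⟨G₀, _, _, I, ⟨e⟩⟩
    refine (Set.finite_range fun g₀ : G₀ => e.symm (h • g₀, 0)).subset ?_
    rintro _ ⟨g, rfl⟩
    refine ⟨(e g).1, ?_⟩
    apply e.injective
    rw [AddEquiv.apply_symm_apply, map_nsmul]
    refine Prod.ext rfl ?_
    ext p
    simp only [Prod.smul_snd, DFinsupp.smul_apply, DFinsupp.zero_apply]
    rw [nsmul_eq_mul, (ZMod.natCast_eq_zero_iff h p.1.1).2 p.1.2.1, zero_mul]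
end

section
/- Let G be a countably infinite abelian group. The dilation 2∗G = {g + g : g ∈ G} is finite if and only if G is isomorphic to G₀ ⊕ Γ₂^∞ for some finite abelian group G₀, where Γ₂^∞ denotes the direct sum of countably infinitely many cyclic groups of order 2. -/
theorem nonempty_linearEquiv_dfinsupp_nat (K V : Type*) [Field K] [Finite K] [AddCommGroup V]
    [Module K V] [Countable V] [Infinite V] : Nonempty (V ≃ₗ[K] (Π₀ _ : ℕ, K)) := by
  classical
  let b := Module.Basis.ofVectorSpace K V
  have : Countable (Module.Basis.ofVectorSpaceIndex K V) := b.injective.countable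
  have : Infinite (Module.Basis.ofVectorSpaceIndex K V) := by
    by_contra h
    rw [not_infinite_iff_finite] at h
    have := Module.Finite.of_basis b
    have : Finite V := Module.finite_of_finite K
    exact not_finite V
  obtain ⟨e⟩ := nonempty_equiv_of_countable (α := Module.Basis.ofVectorSpaceIndex K V) (β := ℕ)
  exact ⟨(b.reindex e).repr.trans (finsuppLequivDFinsupp K)⟩

/-- An abelian group that is the sum of a subgroup `F` and its `2`-torsion is the direct sum of `F`
and a vector space over `ZMod 2`. -/
theorem exists_addEquiv_prod_zmod_two_module {G : Type*} [AddCommGroup G] (F : AddSubgroup G)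
    (hF : ∀ g : G, ∃ s ∈ F, s + s = g + g) :
    ∃ (T : AddSubgroup G) (_ : Module (ZMod 2) T) (Q : Submodule (ZMod 2) T),
      Nonempty (F × Q ≃+ G) := by
  let T : AddSubgroup G := (nsmulAddMonoidHom (α := G) 2).ker
  have hT : ∀ g, g ∈ T ↔ 2 • g = 0 := fun g => Iff.rfl
  let : Module (ZMod 2) T := AddCommGroup.zmodModule fun x => Subtype.ext ((hT x).1 x.2)
  let P : Submodule (ZMod 2) T := AddSubgroup.toZModSubmodule 2 (F.addSubgroupOf T)
  have hP : ∀ x : T, x ∈ P ↔ (x : G) ∈ F := fun x => Iff.rfl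
  obtain ⟨Q, hQ⟩ := P.exists_isCompl
  refine ⟨T, inferInstance, Q, ⟨AddEquiv.ofBijective
    (F.subtype.coprod (T.subtype.comp Q.subtype.toAddMonoidHom)) ⟨?_, ?_⟩⟩⟩
  · rw [injective_iff_map_eq_zero]
    rintro ⟨⟨a, ha⟩, ⟨t, ht⟩⟩ h
    have h : a + (t : G) = 0 := h
    have htF : (t : G) ∈ F := by
      rw [eq_neg_of_add_eq_zero_right h]
      exact F.neg_mem ha
    have ht0 : t = 0 := Submodule.disjoint_def.1 hQ.disjoint t ((hP t).2 htF) ht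
    subst ht0
    have ha0 : a = 0 := by simpa using h
    subst ha0
    rfl
  · intro g
    obtain ⟨s, hs, hsg⟩ := hF g
    have hd : g - s ∈ T := by
      rw [hT, smul_sub, two_nsmul, two_nsmul, hsg, sub_self]
    have hmem : (⟨g - s, hd⟩ : T) ∈ P ⊔ Q := by
      rw [hQ.sup_eq_top]
      trivial
    obtain ⟨p, hp, q, hq, hpq⟩ := Submodule.mem_sup.1 hmem
    have hpq : (p : G) + q = g - s := congrArg Subtype.val hpq
    refine ⟨(⟨s + p, F.add_mem hs ((hP p).1 hp)⟩, ⟨q, hq⟩), ?_⟩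
    change s + (p : G) + q = g
    rw [add_assoc, hpq, add_sub_cancel]

theorem isAddTorsion_of_finite_range_add_self {G : Type*} [AddCommGroup G]
    (h : (Set.range fun g : G => g + g).Finite) : IsAddTorsion G := by
  intro g
  by_contra hg
  have hinj : Function.Injective fun n : ℕ => n • g := injective_nsmul_iff_not_isOfFinAddOrder.2 hg
  refine Set.infinite_range_of_injective
    (f := fun n : ℕ => n • g + n • g) (fun m n hmn => ?_) (h.subset ?_)
  · have : (m + m) • g = (n + n) • g := by simpa only [add_nsmul] using hmn
    have := hinj this
    omega
  · rintro _ ⟨n, rfl⟩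
    exact ⟨n • g, rfl⟩

theorem exists_finite_addSubgroup_add_self_eq {G : Type*} [AddCommGroup G]
    (h : (Set.range fun g : G => g + g).Finite) :
    ∃ F : AddSubgroup G, Finite F ∧ ∀ g : G, ∃ s ∈ F, s + s = g + g := by
  have := h.to_subtype
  choose r hr using fun y : Set.range fun g : G => g + g => y.2
  let F := AddSubgroup.closure (Set.range r)
  have : AddGroup.FG F := AddGroup.closure_finite_fg (Set.range r)
  refine ⟨F, AddCommGroup.finite_of_fg_isAddTorsion F ?_, fun g => ?_⟩
  · exact (isAddTorsion_of_finite_range_add_self h).addSubgroup F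
  · exact ⟨r ⟨g + g, g, rfl⟩, AddSubgroup.subset_closure ⟨_, rfl⟩, hr ⟨g + g, g, rfl⟩⟩

theorem stmt5 {G : Type} [AddCommGroup G] [Countable G] [Infinite G] :
    (Set.range fun g : G => g + g).Finite ↔
      ∃ (G₀ : Type) (_ : AddCommGroup G₀) (_ : Finite G₀),
        Nonempty (G ≃+ G₀ × (Π₀ _ : ℕ, ZMod 2)) := by
  constructor
  · intro h
    obtain ⟨F, hFfin, hF⟩ := exists_finite_addSubgroup_add_self_eq h
    obtain ⟨T, _, Q, ⟨e⟩⟩ := exists_addEquiv_prod_zmod_two_module F hF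
    have : Infinite Q := by
      by_contra hQ
      rw [not_infinite_iff_finite] at hQ
      have : Finite G := Finite.of_equiv _ e.toEquiv
      exact not_finite G
    obtain ⟨f⟩ := nonempty_linearEquiv_dfinsupp_nat (ZMod 2) Q
    exact ⟨F, inferInstance, hFfin, ⟨e.symm.trans ((AddEquiv.refl F).prodCongr f.toAddEquiv)⟩⟩
  · rintro ⟨G₀, _, _, ⟨e⟩⟩
    refine (Set.finite_range fun a : G₀ => e.symm (a, 0)).subset ?_
    rintro _ ⟨g, rfl⟩
    refine ⟨(e g).1 + (e g).1, e.injective ?_⟩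
    rw [e.apply_symm_apply, map_add]
    refine Prod.ext rfl (DFinsupp.ext fun i => ?_)
    exact (CharTwo.add_self_eq_zero ((e g).2 i)).symm
end

section
/- Let G = Γ₂^∞ be an infinite direct sum of cyclic groups of order 2 and let B be a subset of G. If r̂_B(x) ≥ 2 for some x ∈ G, then there exist elements y, z ∈ G such that r̂_B(y) ≥ 2 and r̂_B(z) ≥ 2, and the three elements x, y, z are pairwise distinct. -/
theorem two_le_restrictedRep {X : Type*} [Add X] {B : Set X} {x a b c d : X}
    (ha : a ∈ B) (hb : b ∈ B) (hc : c ∈ B) (hd : d ∈ B) (hab : a ≠ b) (hcd : c ≠ d)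
    (hac : a ≠ c) (had : a ≠ d) (hx : a + b = x) (hx' : c + d = x) :
    2 ≤ restrictedRep B x := by
  have hne : ({a, b} : Set X) ≠ {c, d} := by
    rw [Ne, Set.pair_eq_pair_iff]
    tauto
  rw [← Set.encard_pair hne]
  refine Set.encard_le_encard (Set.pair_subset ?_ ?_)
  · exact ⟨a, ha, b, hb, hab, hx, rfl⟩
  · exact ⟨c, hc, d, hd, hcd, hx', rfl⟩

theorem exists_of_two_le_restrictedRep {X : Type*} [AddCommGroup X] {B : Set X} {x : X}
    (h : 2 ≤ restrictedRep B x) :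
    ∃ a ∈ B, ∃ b ∈ B, ∃ c ∈ B, ∃ d ∈ B, a ≠ b ∧ c ≠ d ∧ a ≠ c ∧ a ≠ d ∧ b ≠ c ∧ b ≠ d ∧
      a + b = x ∧ c + d = x := by
  obtain ⟨_, _, ⟨a, ha, b, hb, hab, hx, rfl⟩, ⟨c, hc, d, hd, hcd, hx', rfl⟩, hne⟩ :=
    Set.one_lt_encard_iff.1 (lt_of_lt_of_le (by norm_num) h)
  rw [Ne, Set.pair_eq_pair_iff] at hne
  refine ⟨a, ha, b, hb, c, hc, d, hd, hab, hcd, ?_, ?_, ?_, ?_, hx, hx'⟩ <;>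
  · rintro rfl
    grind

/-- In an elementary abelian `2`-group, the three pairings of `a, b, c, d` with
`a + b = c + d` give three distinct sums, each represented twice. -/
theorem exists_two_le_restrictedRep_of_add_self {X : Type*} [AddCommGroup X]
    (h2 : ∀ g : X, g + g = 0) {B : Set X} {x : X} (hx : 2 ≤ restrictedRep B x) :
    ∃ y z : X, 2 ≤ restrictedRep B y ∧ 2 ≤ restrictedRep B z ∧ x ≠ y ∧ x ≠ z ∧ y ≠ z := by
  obtain ⟨a, ha, b, hb, c, hc, d, hd, hab, hcd, hac, had, hbc, hbd, rfl, h⟩ :=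
    exists_of_two_le_restrictedRep hx
  have hd' : d = a + b + c := by
    rw [← h, add_right_comm, h2, zero_add]
  have hbd' : b + d = a + c := by
    rw [hd', show b + (a + b + c) = a + c + (b + b) by abel, h2, add_zero]
  have hbc' : b + c = a + d := by
    rw [hd', show a + (a + b + c) = b + c + (a + a) by abel, h2, add_zero]
  exact ⟨a + c, a + d,
    two_le_restrictedRep ha hc hb hd hac hbd hab had rfl hbd',
    two_le_restrictedRep ha hd hb hc had hbc hab hac rfl hbc',
    fun e => hbc (add_left_cancel e), fun e => hbd (add_left_cancel e),
    fun e => hcd (add_left_cancel e)⟩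

theorem stmt7 (B : Set (Π₀ _ : ℕ, ZMod 2)) (x : Π₀ _ : ℕ, ZMod 2)
    (hx : 2 ≤ restrictedRep B x) :
    ∃ y z : Π₀ _ : ℕ, ZMod 2,
      2 ≤ restrictedRep B y ∧ 2 ≤ restrictedRep B z ∧
      x ≠ y ∧ x ≠ z ∧ y ≠ z :=
  exists_two_le_restrictedRep_of_add_self
    (fun g => DFinsupp.ext fun i => CharTwo.add_self_eq_zero (g i)) hx
end

section
/- Let f : ℤ → ℕ₀ ∪ {∞} be any function such that f⁻¹(0) is finite. Then there exists a set B ⊆ ℤ such that r̂_B(x) = f(x) for all x ∈ ℤ; in particular, B is a restricted asymptotic basis of order 2 for ℤ. -/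
/-- The smaller summands of the representations of `x` as a sum of two distinct elements of `B`. -/
def smallSummands (B : Set ℤ) (x : ℤ) : Set ℤ :=
  {p | p ∈ B ∧ x - p ∈ B ∧ 2 * p < x}

theorem restrictedRep_eq_encard_smallSummands (B : Set ℤ) (x : ℤ) :
    restrictedRep B x = (smallSummands B x).encard := by
  have hinj : Set.InjOn (fun p : ℤ ↦ ({p, x - p} : Set ℤ)) (smallSummands B x) := by
    rintro p ⟨-, -, hp⟩ q ⟨-, -, hq⟩ h
    have hmem : p ∈ ({q, x - q} : Set ℤ) := by
      rw [← show ({p, x - p} : Set ℤ) = {q, x - q} from h]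
      simp
    rcases hmem with h | h
    · exact h
    · have h' : p = x - q := h
      omega
  rw [restrictedRep, ← hinj.encard_image]
  congr 1
  ext s
  constructor
  · rintro ⟨b, hb, b', hb', hne, rfl, rfl⟩
    rcases lt_or_gt_of_ne hne with h | h
    · exact ⟨b, ⟨hb, by simpa using hb', by omega⟩, by simp⟩
    · exact ⟨b', ⟨hb', by simpa using hb, by omega⟩, by simp [Set.pair_comm]⟩
  · rintro ⟨p, ⟨hp, hp', hlt⟩, rfl⟩
    exact ⟨p, hp, x - p, hp', by omega, by omega, rfl⟩

theorem smallSummands_mono {B C : Set ℤ} (h : B ⊆ C) (x : ℤ) :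
    smallSummands B x ⊆ smallSummands C x :=
  fun _ hp ↦ ⟨h hp.1, h hp.2.1, hp.2.2⟩

theorem smallSummands_iUnion {B : ℕ → Set ℤ} (hB : Monotone B) (x : ℤ) :
    smallSummands (⋃ n, B n) x = ⋃ n, smallSummands (B n) x := by
  ext p
  simp only [smallSummands, Set.mem_iUnion, Set.mem_ofPred_eq]
  constructor
  · rintro ⟨⟨m, hm⟩, ⟨n, hn⟩, hlt⟩
    exact ⟨max m n, hB (le_max_left m n) hm, hB (le_max_right m n) hn, hlt⟩
  · rintro ⟨n, hp, hp', hlt⟩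
    exact ⟨⟨n, hp⟩, ⟨n, hp'⟩, hlt⟩

theorem Set.Finite.exists_abs_le {s : Set ℤ} (hs : s.Finite) : ∃ M : ℤ, ∀ z ∈ s, |z| ≤ M := by
  obtain ⟨M, hM⟩ := (hs.image abs).bddAbove
  exact ⟨M, fun z hz ↦ hM ⟨z, hz, rfl⟩⟩

/-- A finite set whose representation function is bounded by `f` can be enlarged so that one more
representation of `u` is gained, while keeping the bound. -/
theorem exists_finite_superset_add_one_le {f : ℤ → ℕ∞} (hf : (f ⁻¹' {0}).Finite) {B : Set ℤ}
    (hB : B.Finite) (hBf : ∀ x, (smallSummands B x).encard ≤ f x) {u : ℤ}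
    (hu : (smallSummands B u).encard < f u) :
    ∃ C : Set ℤ, B ⊆ C ∧ C.Finite ∧ (∀ x, (smallSummands C x).encard ≤ f x) ∧
      (smallSummands B u).encard + 1 ≤ (smallSummands C u).encard := by
  obtain ⟨M, hM⟩ := ((hB.union hf).insert u).exists_abs_le
  have huM : -M ≤ u ∧ u ≤ M := abs_le.1 (hM u (by simp))
  have hBM : ∀ b ∈ B, -M ≤ b ∧ b ≤ M := fun b hb ↦ abs_le.1 (hM b (by simp [hb]))
  have hfM : ∀ z, f z = 0 → -M ≤ z ∧ z ≤ M := fun z hz ↦ abs_le.1 (hM z (by simp [hz]))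
  obtain ⟨a, ha⟩ : ∃ a : ℤ, a = -(10 * M + 10) := ⟨_, rfl⟩
  have haB : a ∉ smallSummands B u := fun h ↦ by
    have := hBM a h.1
    omega
  have hBC : B ⊆ insert a (insert (u - a) B) := fun b hb ↦ by simp [hb]
  have hcases : ∀ x p, p ∈ smallSummands (insert a (insert (u - a) B)) x →
      p ∈ smallSummands B x ∨ (x = u ∧ p = a) ∨ (x < -M ∧ p = a) ∨
        (M < x ∧ p = x - (u - a)) := by
    rintro x p ⟨hp, hp', hlt⟩
    rcases hp with hp | hp | hp <;> rcases hp' with hp' | hp' | hp'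
    case inr.inr.inr.inr => exact Or.inl ⟨hp, hp', hlt⟩
    all_goals
      try have h₁ := hBM _ hp
      try have h₂ := hBM _ hp'
      right
      omega
  refine ⟨insert a (insert (u - a) B), hBC, (hB.insert _).insert _, fun x ↦ ?_, ?_⟩
  · by_cases hx : -M ≤ x ∧ x ≤ M
    · by_cases hxu : x = u
      · subst hxu
        calc _ ≤ (insert a (smallSummands B x)).encard := by
              refine Set.encard_le_encard fun p hp ↦ ?_
              rcases hcases x p hp with h | h | h | h
              · exact Or.inr h
              · exact Or.inl h.2
              · exact Or.inl h.2
              · omega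
          _ = (smallSummands B x).encard + 1 := Set.encard_insert_of_notMem haB
          _ ≤ f x := Order.add_one_le_of_lt hu
      · refine (Set.encard_le_encard fun p hp ↦ ?_).trans (hBf x)
        rcases hcases x p hp with h | h | h | h
        · exact h
        all_goals omega
    · have hfx : 1 ≤ f x := Order.one_le_iff_ne_zero.2 fun h ↦ hx (hfM x h)
      by_cases hB0 : (smallSummands B x) = ∅
      · refine le_trans (Set.encard_le_one_iff.2 fun p q hp hq ↦ ?_) hfx
        have hp := hcases x p hp
        have hq := hcases x q hq
        simp only [hB0, Set.mem_empty_iff_false, false_or] at hp hq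
        omega
      · refine (Set.encard_le_encard fun p hp ↦ ?_).trans (hBf x)
        obtain ⟨q, hq⟩ := Set.nonempty_iff_ne_empty.2 hB0
        have h₁ := hBM _ hq.1
        have h₂ := hBM _ hq.2.1
        rcases hp with ⟨hp, hp', hlt⟩
        rcases hp with hp | hp | hp <;> rcases hp' with hp' | hp' | hp'
        case inr.inr.inr.inr => exact ⟨hp, hp', hlt⟩
        all_goals
          try have h₃ := hBM _ hp
          try have h₄ := hBM _ hp'
          omega
  · rw [← Set.encard_insert_of_notMem haB]
    refine Set.encard_le_encard (Set.insert_subset ?_ (smallSummands_mono hBC u))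
    exact ⟨by simp, by simp, by omega⟩

theorem exists_seq_frequently_eq : ∃ e : ℕ → ℤ, ∀ x N, ∃ n, N ≤ n ∧ e n = x :=
  ⟨fun n ↦ Equiv.intEquivNat.symm n.unpair.1, fun x N ↦
    ⟨Nat.pair (Equiv.intEquivNat x) N, Nat.right_le_pair _ _, by simp⟩⟩

theorem exists_encard_smallSummands_eq {f : ℤ → ℕ∞} (hf : (f ⁻¹' {0}).Finite) :
    ∃ B : Set ℤ, ∀ x, (smallSummands B x).encard = f x := by
  obtain ⟨e, he⟩ := exists_seq_frequently_eq
  let T := {B : Set ℤ // B.Finite ∧ ∀ x, (smallSummands B x).encard ≤ f x}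
  have hstep : ∀ (B : T) (u : ℤ), ∃ C : T, B.1 ⊆ C.1 ∧
      ((smallSummands B.1 u).encard < f u →
        (smallSummands B.1 u).encard + 1 ≤ (smallSummands C.1 u).encard) := by
    intro B u
    by_cases hu : (smallSummands B.1 u).encard < f u
    · obtain ⟨C, hBC, hC, hCf, h⟩ := exists_finite_superset_add_one_le hf B.2.1 B.2.2 hu
      exact ⟨⟨C, hC, hCf⟩, hBC, fun _ ↦ h⟩
    · exact ⟨B, subset_rfl, fun h ↦ absurd h hu⟩
  choose next hsub hnext using hstep
  let B : ℕ → T := fun n ↦ Nat.rec ⟨∅, Set.finite_empty, by simp [smallSummands]⟩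
    (fun n C ↦ next C (e n)) n
  have hB : Monotone fun n ↦ (B n).1 := monotone_nat_of_le_succ fun n ↦ hsub (B n) (e n)
  have hmono : ∀ x, Monotone fun n ↦ smallSummands (B n).1 x :=
    fun x m n hmn ↦ smallSummands_mono (hB hmn) x
  refine ⟨⋃ n, (B n).1, fun x ↦ ?_⟩
  rw [smallSummands_iUnion hB]
  apply le_antisymm
  · by_contra! hlt
    obtain ⟨t, ht, htc⟩ := Set.exists_subset_encard_eq (Order.add_one_le_of_lt hlt)
    have hfin : t.Finite := by
      rw [← Set.encard_lt_top_iff, htc]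
      exact WithTop.add_lt_top.2 ⟨hlt.trans_le le_top, ENat.one_lt_top⟩
    obtain ⟨n, hn⟩ := (hmono x).directed_le.exists_mem_subset_of_finset_subset_biUnion
      (s := hfin.toFinset) (by simpa using ht)
    rw [hfin.coe_toFinset] at hn
    have := (Set.encard_le_encard hn).trans ((B n).2.2 x)
    rw [htc] at this
    exact absurd this (not_le.2 ((ENat.lt_add_one_iff (hlt.trans_le le_top).ne).2 le_rfl))
  · by_contra! hlt
    have hle : ∀ n, (smallSummands (B n).1 x).encard ≤ (⋃ n, smallSummands (B n).1 x).encard :=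
      fun n ↦ Set.encard_le_encard (Set.subset_iUnion (fun n ↦ smallSummands (B n).1 x) n)
    have hk : ∀ k : ℕ, ∃ n, (k : ℕ∞) ≤ (smallSummands (B n).1 x).encard := by
      intro k
      induction k with
      | zero => exact ⟨0, by simp⟩
      | succ k ih =>
        obtain ⟨N, hN⟩ := ih
        obtain ⟨n, hNn, rfl⟩ := he x N
        refine ⟨n + 1, le_trans ?_ (hnext (B n) (e n) ((hle n).trans_lt hlt))⟩
        push_cast
        gcongr
        exact hN.trans (Set.encard_le_encard (hmono _ hNn))
    refine hlt.ne_top (ENat.eq_top_iff_forall_ge.2 fun k ↦ ?_)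
    obtain ⟨n, hn⟩ := hk k
    exact hn.trans (hle n)

theorem stmt9 (f : ℤ → ℕ∞) (hf : (f ⁻¹' {0}).Finite) :
    ∃ B : Set ℤ, (∀ x : ℤ, restrictedRep B x = f x) ∧
      {x : ℤ | ¬ 1 ≤ restrictedRep B x}.Finite := by
  obtain ⟨B, hB⟩ := exists_encard_smallSummands_eq hf
  have hrep : ∀ x, restrictedRep B x = f x :=
    fun x ↦ (restrictedRep_eq_encard_smallSummands B x).trans (hB x)
  refine ⟨B, hrep, hf.subset fun x hx ↦ ?_⟩
  simpa [hrep, Order.one_le_iff_ne_zero] using hx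
end

section
/- Consider the abelian semigroup (ℕ₀, ⋆) of nonnegative integers with operation a ⋆ b = max(a,b). Let B ⊆ ℕ₀ be an asymptotic basis or restricted asymptotic basis for (ℕ₀, ⋆), and suppose card(ℕ₀ ∖ B) = t. Then r_B(n) = n + 1 − t and r̂_B(n) = n − t for all sufficiently large n, and consequently limsup_{n→∞} r_B(n) = limsup_{n→∞} r̂_B(n) = ∞. -/
/-- The representation function of `B ⊆ ℕ` in the semigroup `(ℕ, max)`:
`maxRep B n` counts the number of sets `{b, b'} ⊆ B` (with `b = b'` allowed)
such that `max b b' = n`. -/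
noncomputable def maxRep (B : Set ℕ) (n : ℕ) : ℕ∞ :=
  {s : Set ℕ | ∃ b ∈ B, ∃ b' ∈ B, max b b' = n ∧ s = {b, b'}}.encard

/-- The restricted representation function of `B ⊆ ℕ` in the semigroup
`(ℕ, max)`: `maxRestrictedRep B n` counts the number of sets `{b, b'} ⊆ B`
with `b ≠ b'` and `max b b' = n`. -/
noncomputable def maxRestrictedRep (B : Set ℕ) (n : ℕ) : ℕ∞ :=
  {s : Set ℕ | ∃ b ∈ B, ∃ b' ∈ B, b ≠ b' ∧ max b b' = n ∧ s = {b, b'}}.encard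

/-- If `n ∈ B`, the pairs in `B` with maximum `n` are the sets `{b, n}` with `b ∈ B`, `b ≤ n`. -/
theorem maxRep_eq_encard_of_mem {B : Set ℕ} {n : ℕ} (hn : n ∈ B) :
    maxRep B n = (B ∩ Set.Iic n).encard := by
  have hinj : Set.InjOn (fun b : ℕ => ({b, n} : Set ℕ)) (B ∩ Set.Iic n) := by
    intro a _ b _ hab
    have := Set.pair_eq_pair_iff.mp hab
    lia
  rw [maxRep, ← hinj.encard_image]
  congr 1
  ext s
  constructor
  · rintro ⟨b, hb, b', hb', rfl, rfl⟩
    rcases le_total b b' with h | h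
    · exact ⟨b, ⟨hb, by simp⟩, by simp [max_eq_right h]⟩
    · exact ⟨b', ⟨hb', by simp⟩, by simp [max_eq_left h, Set.pair_comm]⟩
  · rintro ⟨b, ⟨hb, hbn⟩, rfl⟩
    exact ⟨b, hb, n, hn, max_eq_right hbn, rfl⟩

/-- If `n ∈ B`, the pairs of distinct elements of `B` with maximum `n` are the sets `{b, n}` with
`b ∈ B`, `b < n`. -/
theorem maxRestrictedRep_eq_encard_of_mem {B : Set ℕ} {n : ℕ} (hn : n ∈ B) :
    maxRestrictedRep B n = (B ∩ Set.Iio n).encard := by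
  have hinj : Set.InjOn (fun b : ℕ => ({b, n} : Set ℕ)) (B ∩ Set.Iio n) := by
    intro a _ b _ hab
    have := Set.pair_eq_pair_iff.mp hab
    lia
  rw [maxRestrictedRep, ← hinj.encard_image]
  congr 1
  ext s
  constructor
  · rintro ⟨b, hb, b', hb', hne, rfl, rfl⟩
    rcases hne.lt_or_gt with h | h
    · exact ⟨b, ⟨hb, by simp [h]⟩, by simp [max_eq_right h.le]⟩
    · exact ⟨b', ⟨hb', by simp [h]⟩, by simp [max_eq_left h.le, Set.pair_comm]⟩
  · rintro ⟨b, ⟨hb, hbn⟩, rfl⟩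
    exact ⟨b, hb, n, hn, ne_of_lt hbn, max_eq_right (le_of_lt hbn), rfl⟩

theorem encard_inter_finset_of_compl_subset {α : Type*} {B : Set α} {t : ℕ}
    (ht : Bᶜ.encard = (t : ℕ∞)) {s : Finset α} (hs : Bᶜ ⊆ (s : Set α)) :
    (B ∩ s).encard = ((s.card - t : ℕ) : ℕ∞) := by
  have h := Set.encard_sdiff_add_encard_of_subset hs
  rw [Set.sdiff_compl, Set.inter_comm, ht, Set.encard_coe_eq_coe_finsetCard] at h
  have hfin : (B ∩ s).Finite := s.finite_toSet.inter_of_right B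
  rw [← hfin.cast_ncard_eq] at h ⊢
  norm_cast at h ⊢
  lia

/-- A function agreeing eventually with `n ↦ f n`, where `f` tends to infinity, has limsup `⊤`. -/
theorem limsup_eq_top_of_eventuallyEq_natCast {g : ℕ → ℕ∞} {f : ℕ → ℕ}
    (hf : Filter.Tendsto f Filter.atTop Filter.atTop)
    (hg : g =ᶠ[Filter.atTop] fun n => (f n : ℕ∞)) :
    Filter.atTop.limsup g = ⊤ :=
  ((ENat.tendsto_natCast_nhds_top.comp hf).congr' hg.symm).limsup_eq

theorem stmt13 (B : Set ℕ) (t : ℕ)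
    (hbasis : {n : ℕ | ¬ 1 ≤ maxRep B n}.Finite ∨ {n : ℕ | ¬ 1 ≤ maxRestrictedRep B n}.Finite)
    (ht : Bᶜ.encard = (t : ℕ∞)) :
    (∃ N : ℕ, ∀ n : ℕ, N ≤ n →
      maxRep B n = ((n + 1 - t : ℕ) : ℕ∞) ∧
      maxRestrictedRep B n = ((n - t : ℕ) : ℕ∞)) ∧
    Filter.atTop.limsup (fun n : ℕ => maxRep B n) = ⊤ ∧
    Filter.atTop.limsup (fun n : ℕ => maxRestrictedRep B n) = ⊤ := by
  obtain ⟨N, hN⟩ := (Set.finite_of_encard_eq_coe ht).bddAbove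
  have key : ∀ n : ℕ, N + 1 ≤ n →
      maxRep B n = ((n + 1 - t : ℕ) : ℕ∞) ∧ maxRestrictedRep B n = ((n - t : ℕ) : ℕ∞) := by
    intro n hn
    have hlt : ∀ m ∈ Bᶜ, m < n := fun m hm => (hN hm).trans_lt hn
    have hnB : n ∈ B := by
      by_contra h
      exact (hlt n h).false
    rw [maxRep_eq_encard_of_mem hnB, maxRestrictedRep_eq_encard_of_mem hnB,
      ← Finset.coe_Iic, ← Finset.coe_Iio,
      encard_inter_finset_of_compl_subset ht fun m hm => by simpa using (hlt m hm).le,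
      encard_inter_finset_of_compl_subset ht fun m hm => by simpa using hlt m hm,
      Nat.card_Iic, Nat.card_Iio]
    exact ⟨rfl, rfl⟩
  refine ⟨⟨N + 1, key⟩, ?_, ?_⟩
  · refine limsup_eq_top_of_eventuallyEq_natCast (f := fun n => n + 1 - t) ?_ ?_
    · exact (Filter.tendsto_sub_atTop_nat t).comp (Filter.tendsto_add_atTop_nat 1)
    · filter_upwards [Filter.eventually_ge_atTop (N + 1)] with n hn using (key n hn).1
  · refine limsup_eq_top_of_eventuallyEq_natCast (Filter.tendsto_sub_atTop_nat t) ?_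
    filter_upwards [Filter.eventually_ge_atTop (N + 1)] with n hn using (key n hn).2
end

section
/- There exists a subset B of G = Γ₂^∞, the infinite direct sum of cyclic groups of order 2, such that r_B(x) = 1 for all x ∈ G with x ≠ 0; in particular, B is a basis of order 2 for G when 0 is represented (note r_B(0) = card(B) ≥ 1 for nonempty B). -/
/-- A Sidon set in a group of exponent two: four elements summing to zero cancel in pairs. -/
def IsSidonTwo {G : Type*} [AddCommGroup G] (A : Set G) : Prop :=
  ∀ a ∈ A, ∀ b ∈ A, ∀ c ∈ A, ∀ d ∈ A, a + b + c + d = 0 → a = b ∨ a = c ∨ a = d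

section

variable {G : Type*} [AddCommGroup G]

lemma IsSidonTwo.insert (h2 : ∀ x : G, x + x = 0) {A : Set G} (hA : IsSidonTwo A) {z : G}
    (hz : ∀ a ∈ A, ∀ b ∈ A, ∀ c ∈ A, z ≠ a + b + c) : IsSidonTwo (insert z A) := by
  have hz2 := h2 z
  rintro a (rfl | ha) b (rfl | hb) c (rfl | hc) d (rfl | hd) h <;> grind [IsSidonTwo]

lemma IsSidonTwo.exists_extension [Infinite G] (h2 : ∀ x : G, x + x = 0) {A : Finset G}
    (hA : IsSidonTwo (A : Set G)) {x : G} (hx : x ≠ 0) :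
    ∃ A' : Finset G, A ⊆ A' ∧ IsSidonTwo (A' : Set G) ∧ ∃ b ∈ A', ∃ b' ∈ A', b + b' = x := by
  classical
  by_cases hxA : ∃ b ∈ A, ∃ b' ∈ A, b + b' = x
  · exact ⟨A, subset_rfl, hA, hxA⟩
  push Not at hxA
  let T : Finset G := (A ×ˢ A ×ˢ A).image fun p ↦ p.1 + p.2.1 + p.2.2
  obtain ⟨y, hy⟩ := Infinite.exists_notMem_finset (T ∪ T.image (x + ·) ∪ A.image (x + ·))
  simp only [T, Finset.mem_union, Finset.mem_image, Finset.mem_product, Prod.exists, not_or,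
    not_exists, not_and] at hy
  obtain ⟨⟨hy₁, hy₂⟩, hy₃⟩ := hy
  have hA₁ : IsSidonTwo (Insert.insert y (A : Set G)) :=
    hA.insert h2 fun a ha b hb c hc h ↦ hy₁ a b c ⟨ha, hb, hc⟩ h.symm
  refine ⟨Insert.insert (x + y) (Insert.insert y A), by grind, ?_, x + y, by simp, y, by simp, ?_⟩
  · push_cast
    refine hA₁.insert h2 ?_
    have hy2 := h2 y
    have hx2 := h2 x
    have hy₂' : ∀ a ∈ A, ∀ b ∈ A, ∀ c ∈ A, x + (a + b + c) ≠ y :=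
      fun a ha b hb c hc ↦ hy₂ _ ⟨a, b, c, ⟨ha, hb, hc⟩, rfl⟩
    rintro a (rfl | ha) b (rfl | hb) c (rfl | hc) h <;> grind
  · rw [add_assoc, h2, add_zero]

lemma exists_isSidonTwo_basis [Infinite G] [Countable G] (h2 : ∀ x : G, x + x = 0) :
    ∃ B : Set G, IsSidonTwo B ∧ ∀ x ≠ 0, ∃ b ∈ B, ∃ b' ∈ B, b + b' = x := by
  let P := {A : Finset G // IsSidonTwo (A : Set G)}
  let _ : Encodable {x : G // x ≠ 0} := Encodable.ofCountable _
  let D : {x : G // x ≠ 0} → Order.Cofinal P := fun x ↦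
    { carrier := {A | ∃ b ∈ A.1, ∃ b' ∈ A.1, b + b' = x.1}
      isCofinal := fun A ↦
        let ⟨A', hAA', hA', h⟩ := A.2.exists_extension h2 x.2
        ⟨⟨A', hA'⟩, h, hAA'⟩ }
  let I := Order.idealOfCofinals (⟨∅, by simp [IsSidonTwo]⟩ : P) D
  refine ⟨{g | ∃ A ∈ I, g ∈ A.1}, ?_, fun x hx ↦ ?_⟩
  · rintro a ⟨A, hA, ha⟩ b ⟨B, hB, hb⟩ c ⟨C, hC, hc⟩ d ⟨E, hE, hd⟩
    obtain ⟨U, hU, hAU, hBU⟩ := I.directed A hA B hB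
    obtain ⟨V, hV, hCV, hEV⟩ := I.directed C hC E hE
    obtain ⟨W, hW, hUW, hVW⟩ := I.directed U hU V hV
    exact W.2 a (hUW (hAU ha)) b (hUW (hBU hb)) c (hVW (hCV hc)) d (hVW (hEV hd))
  · obtain ⟨A, ⟨b, hb, b', hb', h⟩, hA⟩ :=
      Order.cofinal_meets_idealOfCofinals (⟨∅, by simp [IsSidonTwo]⟩ : P) D ⟨x, hx⟩
    exact ⟨b, ⟨A, hA, hb⟩, b', ⟨A, hA, hb'⟩, h⟩

lemma IsSidonTwo.rep_eq_one (h2 : ∀ x : G, x + x = 0) {B : Set G} (hB : IsSidonTwo B) {x : G}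
    (hx : x ≠ 0) (h : ∃ b ∈ B, ∃ b' ∈ B, b + b' = x) : rep B x = 1 := by
  obtain ⟨b, hb, b', hb', rfl⟩ := h
  refine Set.encard_eq_one.2 ⟨{b, b'}, Set.eq_singleton_iff_unique_mem.2
    ⟨⟨b, hb, b', hb', rfl, rfl⟩, ?_⟩⟩
  rintro _ ⟨c, hc, c', hc', hcc, rfl⟩
  have hsum : c + c' + b + b' = 0 := by rw [hcc, add_assoc, h2]
  rcases hB c hc c' hc' b hb b' hb' hsum with rfl | rfl | rfl
  · exact absurd (hcc.symm.trans (h2 c)) hx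
  · rw [add_left_cancel hcc]
  · rw [add_comm b, add_left_cancel_iff] at hcc
    rw [hcc, Set.pair_comm]

end

theorem stmt16 :
    ∃ B : Set (Π₀ _ : ℕ, ZMod 2), B.Nonempty ∧
      ∀ x : Π₀ _ : ℕ, ZMod 2, x ≠ 0 → rep B x = 1 := by
  have h2 (x : Π₀ _ : ℕ, ZMod 2) : x + x = 0 := by
    ext i
    exact CharTwo.add_self_eq_zero (x i)
  let e : (ℕ →₀ ZMod 2) ≃ Π₀ _ : ℕ, ZMod 2 := finsuppEquivDFinsupp
  have : Countable (Π₀ _ : ℕ, ZMod 2) := e.symm.injective.countable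
  have : Infinite (Π₀ _ : ℕ, ZMod 2) := e.infinite_iff.1 inferInstance
  obtain ⟨B, hB, hrep⟩ := exists_isSidonTwo_basis h2
  obtain ⟨x, hx⟩ := exists_ne (0 : Π₀ _ : ℕ, ZMod 2)
  obtain ⟨b, hb, -⟩ := hrep x hx
  exact ⟨B, ⟨b, hb⟩, fun x hx ↦ hB.rep_eq_one h2 hx (hrep x hx)⟩
end
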